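/- arXiv:2312.02495 — 2 statements merged into one kernel-verified Lean document; each statement's English description precedes it below -/
import Mathlib

section
/- For $f : \mathbb{Z}_p^n \to \mathbb{C}$ locally constant on cosets of $p^\ell \mathbb{Z}_p^n$, and $u \in \mathbb{P}\mathbb{Z}_p^{n-1}$, one has $\sum_{a \in u^\perp} |\hat f(a)|^2 = \int_{\mathbb{Z}_p^n} \int_{\mathbb{Z}_p} f(z) \overline{f(z + t u)}\, dt\, dz$, where $u^\perp = \{a \in (\mathbb{Z}[1/p]/\mathbb{Z})^n : \langle u, a \rangle = 0\}$ and $\hat f(a) = \int_{\mathbb{Z}_p^n} e^{2\pi i \langle x, a \rangle} f(x)\, dx$. -/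
open MeasureTheory

noncomputable section

instance (p : ℕ) [Fact p.Prime] : MeasurableSpace ℤ_[p] := borel _
instance (p : ℕ) [Fact p.Prime] : BorelSpace ℤ_[p] := ⟨rfl⟩

/-- The Haar probability measure on `ℤ_p^n`. -/
def padicHaar (p : ℕ) [Fact p.Prime] (n : ℕ) : Measure (Fin n → ℤ_[p]) :=
  Measure.addHaarMeasure ⟨⟨Set.univ, isCompact_univ⟩, by simp⟩

/-- The Haar probability measure on `ℤ_p`. -/
def haarZp (p : ℕ) [Fact p.Prime] : Measure ℤ_[p] :=
  Measure.addHaarMeasure ⟨⟨Set.univ, isCompact_univ⟩, by simp⟩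

/-- `e : ℚ/ℤ → ℂ`, `q ↦ e^{2πiq}` (computed via any rational representative). -/
def eChar (q : AddCircle (1 : ℚ)) : ℂ :=
  Complex.exp (2 * Real.pi * Complex.I * (q.out : ℚ))

/-- The pairing `ℤ_p × (ℤ[1/p]/ℤ) → ℚ/ℤ`: an element `a` of the `p`-primary part of
`ℚ/ℤ` has additive order `p^ℓ`, and `⟨x, a⟩ = (x mod p^ℓ) • a`. -/
def pairing (p : ℕ) [Fact p.Prime] (x : ℤ_[p]) (q : AddCircle (1 : ℚ)) :
    AddCircle (1 : ℚ) :=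
  (PadicInt.toZModPow ((addOrderOf q).factorization p) x).val • q

/-- The pairing `⟨x, a⟩ = ∑ i, x i · a i ∈ ℚ/ℤ` of `x ∈ ℤ_p^n` with a vector `a` of
`p`-power torsion elements of `ℚ/ℤ` (modelling the dual group `(ℤ[1/p]/ℤ)^n`). -/
def pairingVec (p : ℕ) [Fact p.Prime] (n : ℕ) (x : Fin n → ℤ_[p])
    (a : Fin n → AddCircle (1 : ℚ)) : AddCircle (1 : ℚ) :=
  ∑ i, pairing p (x i) (a i)

/-- The Fourier transform of `f : ℤ_p^n → ℂ` at a dual element `a`. -/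
def fourierZp (p : ℕ) [Fact p.Prime] (n : ℕ) (f : (Fin n → ℤ_[p]) → ℂ)
    (a : Fin n → AddCircle (1 : ℚ)) : ℂ :=
  ∫ x, eChar (pairingVec p n x a) * f x ∂(padicHaar p n)

theorem eChar_coe (r : ℚ) :
    eChar (r : AddCircle (1 : ℚ)) = Complex.exp (2 * Real.pi * Complex.I * r) := by
  have h : ((Quotient.out (r : AddCircle (1 : ℚ)) - r : ℚ) : AddCircle (1 : ℚ)) = 0 := by
    rw [AddCircle.coe_sub, sub_eq_zero]
    exact QuotientAddGroup.out_eq' _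
  obtain ⟨k, hk⟩ := (AddCircle.coe_eq_zero_iff 1).1 h
  rw [eChar, Complex.exp_eq_exp_iff_exists_int]
  refine ⟨k, ?_⟩
  have hk' : (Quotient.out (r : AddCircle (1 : ℚ)) : ℚ) = r + k := by
    rw [zsmul_one] at hk
    linarith
  rw [hk']
  push_cast
  ring

theorem eChar_add (q r : AddCircle (1 : ℚ)) : eChar (q + r) = eChar q * eChar r := by
  induction q using QuotientAddGroup.induction_on with | H q
  induction r using QuotientAddGroup.induction_on with | H r
  rw [← AddCircle.coe_add, eChar_coe, eChar_coe, eChar_coe, ← Complex.exp_add]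
  push_cast
  ring_nf

theorem eq_zero_of_eChar_eq_one {q : AddCircle (1 : ℚ)} (h : eChar q = 1) : q = 0 := by
  induction q using QuotientAddGroup.induction_on with | H q
  rw [eChar_coe, Complex.exp_eq_one_iff] at h
  obtain ⟨k, hk⟩ := h
  refine (AddCircle.coe_eq_zero_iff 1).2 ⟨k, ?_⟩
  rw [mul_comm (k : ℂ)] at hk
  have := mul_left_cancel₀ Complex.two_pi_I_ne_zero hk
  rw [zsmul_one]
  exact_mod_cast this.symm

theorem pairing_eq_of_nsmul_eq_zero {p : ℕ} [Fact p.Prime] (x : ℤ_[p]) {q : AddCircle (1 : ℚ)}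
    {m : ℕ} (h : p ^ m • q = 0) : pairing p x q = (PadicInt.toZModPow m x).val • q := by
  have hp : p.Prime := Fact.out
  obtain ⟨k, hkm, hk⟩ := (Nat.dvd_prime_pow hp).1 (addOrderOf_dvd_of_nsmul_eq_zero h)
  have hfac : (addOrderOf q).factorization p = k := by
    rw [hk, hp.factorization_pow, Finsupp.single_eq_same]
  rw [pairing, hfac, nsmul_eq_nsmul_iff_modEq, hk, ← ZMod.natCast_eq_natCast_iff,
    ZMod.natCast_zmod_val, ZMod.natCast_val, PadicInt.cast_toZModPow _ _ hkm]

theorem pairing_add {p : ℕ} [Fact p.Prime] (x y : ℤ_[p]) {q : AddCircle (1 : ℚ)}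
    {m : ℕ} (h : p ^ m • q = 0) : pairing p (x + y) q = pairing p x q + pairing p y q := by
  rw [pairing_eq_of_nsmul_eq_zero _ h, pairing_eq_of_nsmul_eq_zero _ h,
    pairing_eq_of_nsmul_eq_zero _ h, ← add_nsmul, nsmul_eq_nsmul_iff_modEq]
  refine Nat.ModEq.of_dvd (addOrderOf_dvd_of_nsmul_eq_zero h) ?_
  rw [← ZMod.natCast_eq_natCast_iff]
  simp

theorem pairing_natCast {p : ℕ} [Fact p.Prime] (k : ℕ) {q : AddCircle (1 : ℚ)}
    {m : ℕ} (h : p ^ m • q = 0) : pairing p (k : ℤ_[p]) q = k • q := by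
  rw [pairing_eq_of_nsmul_eq_zero _ h, nsmul_eq_nsmul_iff_modEq]
  refine Nat.ModEq.of_dvd (addOrderOf_dvd_of_nsmul_eq_zero h) ?_
  rw [← ZMod.natCast_eq_natCast_iff]
  simp

theorem pairingVec_add {p : ℕ} [Fact p.Prime] {n : ℕ} (x y : Fin n → ℤ_[p])
    {a : Fin n → AddCircle (1 : ℚ)} (ha : ∀ i, ∃ m : ℕ, p ^ m • a i = 0) :
    pairingVec p n (x + y) a = pairingVec p n x a + pairingVec p n y a := by
  simp_rw [pairingVec, ← Finset.sum_add_distrib]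
  exact Finset.sum_congr rfl fun i _ ↦ pairing_add _ _ (ha i).choose_spec

/-- The embedding `k ↦ k / N` of `ℤ/N` into `ℚ/ℤ`. -/
def zmodToAddCircle (N : ℕ) [NeZero N] : ZMod N →+ AddCircle (1 : ℚ) :=
  ZMod.lift N ⟨zmultiplesHom _ ((1 / N : ℚ) : AddCircle (1 : ℚ)), by
    rw [zmultiplesHom_apply, ← AddCircle.coe_zsmul, AddCircle.coe_eq_zero_iff]
    exact ⟨1, by simp [NeZero.ne N]⟩⟩

theorem zmodToAddCircle_intCast (N : ℕ) [NeZero N] (k : ℤ) :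
    zmodToAddCircle N k = ((k / N : ℚ) : AddCircle (1 : ℚ)) := by
  rw [zmodToAddCircle, ZMod.lift_coe, zmultiplesHom_apply, ← AddCircle.coe_zsmul, zsmul_eq_mul,
    mul_one_div]

theorem eChar_zmodToAddCircle (N : ℕ) [NeZero N] (c : ZMod N) :
    eChar (zmodToAddCircle N c) = ZMod.stdAddChar c := by
  obtain ⟨k, rfl⟩ := ZMod.intCast_surjective c
  rw [zmodToAddCircle_intCast, eChar_coe, ZMod.stdAddChar_coe]
  push_cast
  rw [mul_div_assoc]

theorem zmodToAddCircle_injective (N : ℕ) [NeZero N] :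
    Function.Injective (zmodToAddCircle N) := fun b c h ↦
  ZMod.injective_stdAddChar (by rw [← eChar_zmodToAddCircle, h, eChar_zmodToAddCircle])

theorem nsmul_zmodToAddCircle (N : ℕ) [NeZero N] (c : ZMod N) :
    N • zmodToAddCircle N c = 0 := by
  rw [← map_nsmul]
  simp

theorem exists_zmodToAddCircle_eq {N : ℕ} [NeZero N] {q : AddCircle (1 : ℚ)} (h : N • q = 0) :
    ∃ c, zmodToAddCircle N c = q := by
  induction q using QuotientAddGroup.induction_on with | H q
  obtain ⟨k, hk⟩ := (AddCircle.coe_eq_zero_iff (1 : ℚ) (x := N • q)).1 h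
  refine ⟨k, ?_⟩
  rw [zmodToAddCircle_intCast]
  have hN : (N : ℚ) ≠ 0 := NeZero.ne _
  congr 1
  rw [zsmul_one, nsmul_eq_mul] at hk
  rw [hk]
  field_simp

/-- Coordinatewise reduction `ℤ_p^n → (ℤ/p^ℓ)^n`. -/
def reduceVec (p : ℕ) [Fact p.Prime] (n ℓ : ℕ) : (Fin n → ℤ_[p]) →+ (Fin n → ZMod (p ^ ℓ)) :=
  (PadicInt.toZModPow (p := p) ℓ).toAddMonoidHom.compLeft (Fin n)

theorem pairingVec_zmodToAddCircle {p : ℕ} [Fact p.Prime] {n ℓ : ℕ} (x : Fin n → ℤ_[p])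
    (b : Fin n → ZMod (p ^ ℓ)) :
    pairingVec p n x (fun i ↦ zmodToAddCircle (p ^ ℓ) (b i)) =
      zmodToAddCircle (p ^ ℓ) (reduceVec p n ℓ x ⬝ᵥ b) := by
  rw [pairingVec, dotProduct, map_sum]
  refine Finset.sum_congr rfl fun i _ ↦ ?_
  rw [pairing_eq_of_nsmul_eq_zero _ (nsmul_zmodToAddCircle _ _), ← map_nsmul, nsmul_eq_mul,
    ZMod.natCast_zmod_val]
  rfl

theorem isLocallyConstant_toZModPow (p : ℕ) [Fact p.Prime] (ℓ : ℕ) :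
    IsLocallyConstant (PadicInt.toZModPow (p := p) ℓ) := by
  refine (IsLocallyConstant.iff_exists_open _).2 fun x ↦
    ⟨Metric.ball x ((p : ℝ) ^ (-(ℓ : ℤ) + 1)), Metric.isOpen_ball, Metric.mem_ball_self
      (zpow_pos (by exact_mod_cast (Fact.out : p.Prime).pos) _), fun y hy ↦ ?_⟩
  rw [← sub_eq_zero, ← map_sub, ← RingHom.mem_ker, PadicInt.ker_toZModPow,
    ← PadicInt.norm_le_pow_iff_mem_span_pow, PadicInt.norm_le_pow_iff_norm_lt_pow_add_one,
    ← dist_eq_norm]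
  exact hy

theorem isLocallyConstant_reduceVec (p : ℕ) [Fact p.Prime] (n ℓ : ℕ) :
    IsLocallyConstant (reduceVec p n ℓ) := by
  refine (IsLocallyConstant.iff_exists_open _).2 fun x ↦
    ⟨Set.univ.pi fun i ↦ PadicInt.toZModPow ℓ ⁻¹' {PadicInt.toZModPow ℓ (x i)},
      isOpen_set_pi Set.finite_univ fun i _ ↦ isLocallyConstant_toZModPow p ℓ _,
      fun i _ ↦ rfl, fun y hy ↦ funext fun i ↦ hy i trivial⟩

theorem toZModPow_surjective (p : ℕ) [Fact p.Prime] (ℓ : ℕ) :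
    Function.Surjective (PadicInt.toZModPow (p := p) ℓ) := fun c ↦
  ⟨c.val, by simp⟩

theorem reduceVec_surjective (p : ℕ) [Fact p.Prime] (n ℓ : ℕ) :
    Function.Surjective (reduceVec p n ℓ) :=
  (toZModPow_surjective p ℓ).comp_left

theorem integral_comp_of_surjective {X G : Type*} [AddCommGroup X] [TopologicalSpace X]
    [CompactSpace X] [MeasurableSpace X] [BorelSpace X] [MeasurableAdd X]
    (μ : Measure X) [IsProbabilityMeasure μ]
    [μ.IsAddLeftInvariant] [AddCommGroup G] [Fintype G] (φ : X →+ G)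
    (hφ : IsLocallyConstant φ) (hsurj : Function.Surjective φ) (h : G → ℂ) :
    ∫ x, h (φ x) ∂μ = (Fintype.card G : ℂ)⁻¹ * ∑ g, h g := by
  have hint (k : G → ℂ) : Integrable (fun x ↦ k (φ x)) μ :=
    (hφ.comp k).continuous.integrable_of_hasCompactSupport (HasCompactSupport.of_compactSpace _)
  have hinv (g : G) : ∫ x, h (g + φ x) ∂μ = ∫ x, h (φ x) ∂μ := by
    obtain ⟨y, rfl⟩ := hsurj g
    simp_rw [← map_add]
    exact integral_add_left_eq_self (fun x ↦ h (φ x)) y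
  have hsum : ∑ g : G, ∫ x, h (g + φ x) ∂μ = ∑ g, h g := by
    rw [← integral_finsetSum _ fun g _ ↦ hint fun b ↦ h (g + b)]
    have hshift (x : X) : ∑ g, h (g + φ x) = ∑ g, h g :=
      Equiv.sum_comp (Equiv.addRight (φ x)) h
    simp [hshift]
  simp_rw [hinv, Finset.sum_const, Finset.card_univ, nsmul_eq_mul] at hsum
  rw [← hsum, inv_mul_cancel_left₀ (by exact_mod_cast Fintype.card_ne_zero)]

instance (p : ℕ) [Fact p.Prime] (n : ℕ) : IsProbabilityMeasure (padicHaar p n) :=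
  ⟨Measure.addHaarMeasure_self⟩
instance (p : ℕ) [Fact p.Prime] (n : ℕ) : (padicHaar p n).IsAddLeftInvariant := by
  unfold padicHaar; infer_instance
instance (p : ℕ) [Fact p.Prime] : IsProbabilityMeasure (haarZp p) :=
  ⟨Measure.addHaarMeasure_self⟩
instance (p : ℕ) [Fact p.Prime] : (haarZp p).IsAddLeftInvariant := by
  unfold haarZp; infer_instance

theorem sum_stdAddChar_dotProduct {n N : ℕ} [NeZero N] (w : Fin n → ZMod N) :
    ∑ b : Fin n → ZMod N, ZMod.stdAddChar (w ⬝ᵥ b) = if w = 0 then (N : ℂ) ^ n else 0 := by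
  have hprod (b : Fin n → ZMod N) :
      ZMod.stdAddChar (w ⬝ᵥ b) = ∏ i, ZMod.stdAddChar (b i * w i) := by
    simp_rw [dotProduct, mul_comm (w _)]
    exact map_prod ZMod.stdAddChar.toMonoidHom (fun i ↦ Multiplicative.ofAdd (b i * w i)) _
  simp_rw [hprod]
  rw [← Fintype.prod_sum fun i c ↦ ZMod.stdAddChar (c * w i)]
  simp_rw [AddChar.sum_mulShift _ (ZMod.isPrimitive_stdAddChar N), ZMod.card]
  split_ifs with hw
  · simp [hw]
  · obtain ⟨i, hi⟩ := Function.ne_iff.1 hw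
    exact Finset.prod_eq_zero (Finset.mem_univ i)
      (by rw [if_neg (show w i ≠ 0 from hi), Nat.cast_zero])

theorem sum_orthogonal_norm_sq {n N : ℕ} [NeZero N] (F : (Fin n → ZMod N) → ℂ)
    (v : Fin n → ZMod N) :
    ∑ b, (if v ⬝ᵥ b = 0 then ((‖∑ x, ZMod.stdAddChar (x ⬝ᵥ b) * F x‖ ^ 2 : ℝ) : ℂ) else 0) =
      (N : ℂ) ^ n * (N : ℂ)⁻¹ * ∑ z, ∑ t : ZMod N, F z * starRingEnd ℂ (F (z + t • v)) := by
  have hN : (N : ℂ) ≠ 0 := NeZero.ne _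
  have hterm (b : Fin n → ZMod N) :
      (if v ⬝ᵥ b = 0 then ((‖∑ x, ZMod.stdAddChar (x ⬝ᵥ b) * F x‖ ^ 2 : ℝ) : ℂ) else 0) =
        (N : ℂ)⁻¹ * ∑ x, ∑ t : ZMod N, ∑ y,
          F x * starRingEnd ℂ (F y) * ZMod.stdAddChar ((x + t • v - y) ⬝ᵥ b) := by
    have hind : (if v ⬝ᵥ b = 0 then (1 : ℂ) else 0) =
        (N : ℂ)⁻¹ * ∑ t : ZMod N, ZMod.stdAddChar (t * (v ⬝ᵥ b)) := by
      rw [AddChar.sum_mulShift _ (ZMod.isPrimitive_stdAddChar N), ZMod.card]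
      split_ifs <;> simp [hN]
    rw [← mul_one (Complex.ofReal _), ← mul_ite_zero, hind, Complex.ofReal_pow,
      ← Complex.mul_conj', map_sum, mul_left_comm, Finset.sum_mul_sum, Finset.sum_mul]
    congr 1
    refine Finset.sum_congr rfl fun x _ ↦ ?_
    rw [Finset.sum_mul_sum, Finset.sum_comm]
    refine Finset.sum_congr rfl fun t _ ↦ Finset.sum_congr rfl fun y _ ↦ ?_
    rw [sub_dotProduct, add_dotProduct, smul_dotProduct, sub_eq_add_neg, AddChar.map_add_eq_mul,
      AddChar.map_add_eq_mul, AddChar.map_neg_eq_conj, map_mul, smul_eq_mul]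
    ring
  simp_rw [hterm]
  rw [← Finset.mul_sum, mul_comm (_ ^ n), mul_assoc, Finset.sum_comm, Finset.mul_sum _ _ (_ ^ n)]
  congr 1
  refine Finset.sum_congr rfl fun x _ ↦ ?_
  rw [Finset.sum_comm, Finset.mul_sum]
  refine Finset.sum_congr rfl fun t _ ↦ ?_
  rw [Finset.sum_comm]
  simp_rw [← Finset.mul_sum, sum_stdAddChar_dotProduct, sub_eq_zero]
  simp only [mul_ite, mul_zero, Finset.sum_ite_eq, Finset.mem_univ, if_true]
  ring

theorem exists_eq_comp_reduceVec {p : ℕ} [Fact p.Prime] {n ℓ : ℕ} {f : (Fin n → ℤ_[p]) → ℂ}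
    (hf : ∀ x y : Fin n → ℤ_[p], (∀ i, (p : ℤ_[p]) ^ ℓ ∣ (x i - y i)) → f x = f y) :
    ∃ F : (Fin n → ZMod (p ^ ℓ)) → ℂ, ∀ x, f x = F (reduceVec p n ℓ x) := by
  refine ⟨fun g ↦ f (Function.surjInv (reduceVec_surjective p n ℓ) g), fun x ↦
    hf _ _ fun i ↦ ?_⟩
  rw [← Ideal.mem_span_singleton, ← PadicInt.ker_toZModPow, RingHom.mem_ker, map_sub, sub_eq_zero]
  exact congrFun (Function.surjInv_eq (reduceVec_surjective p n ℓ) (reduceVec p n ℓ x)).symm i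

theorem fourierZp_eq_zero {p : ℕ} [Fact p.Prime] {n ℓ : ℕ} {f : (Fin n → ℤ_[p]) → ℂ}
    (hf : ∀ x y : Fin n → ℤ_[p], (∀ i, (p : ℤ_[p]) ^ ℓ ∣ (x i - y i)) → f x = f y)
    {a : Fin n → AddCircle (1 : ℚ)} (ha : ∀ i, ∃ m : ℕ, p ^ m • a i = 0) {j : Fin n}
    (hj : p ^ ℓ • a j ≠ 0) : fourierZp p n f a = 0 := by
  set w : Fin n → ℤ_[p] := Pi.single j ((p ^ ℓ : ℕ) : ℤ_[p]) with hw
  have hwa : pairingVec p n w a = p ^ ℓ • a j := by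
    rw [pairingVec, Finset.sum_eq_single j, hw, Pi.single_eq_same,
      pairing_natCast _ (ha j).choose_spec]
    · intro i _ hi
      rw [hw, Pi.single_eq_of_ne hi, ← Nat.cast_zero, pairing_natCast _ (ha i).choose_spec,
        zero_nsmul]
    · simp
  have hshift : eChar (pairingVec p n w a) * fourierZp p n f a = fourierZp p n f a := by
    rw [fourierZp, ← integral_const_mul]
    conv_rhs => rw [← integral_add_left_eq_self _ w]
    refine integral_congr_ae (.of_forall fun x ↦ ?_)
    have hfx : f (w + x) = f x := hf _ _ fun i ↦ by
      by_cases hi : i = j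
      · subst hi; simp [hw]
      · simp [hw, hi]
    simp only [hfx, pairingVec_add _ _ ha, eChar_add, mul_assoc]
  by_contra hne
  exact hj (hwa ▸ eq_zero_of_eChar_eq_one ((mul_eq_right₀ hne).1 hshift))

theorem stmt7 (p : ℕ) [Fact p.Prime] (n ℓ : ℕ) (hn : 1 ≤ n)
    (f : (Fin n → ℤ_[p]) → ℂ)
    (hf : ∀ x y : Fin n → ℤ_[p], (∀ i, (p : ℤ_[p]) ^ ℓ ∣ (x i - y i)) → f x = f y)
    (u : Fin n → ℤ_[p]) (hu : ∃ i, IsUnit (u i)) :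
    ((∑' a : {a : Fin n → AddCircle (1 : ℚ) //
        (∀ i, ∃ m : ℕ, (p ^ m : ℕ) • a i = 0) ∧ pairingVec p n u a = 0},
      ‖fourierZp p n f a.1‖ ^ 2 : ℝ) : ℂ) =
      ∫ z, ∫ t, f z * starRingEnd ℂ (f (z + t • u)) ∂(haarZp p) ∂(padicHaar p n) := by
  obtain ⟨F, hF⟩ := exists_eq_comp_reduceVec hf
  have hcard : (Fintype.card (Fin n → ZMod (p ^ ℓ)) : ℂ) = ((p ^ ℓ : ℕ) : ℂ) ^ n := by simp
  have hfourier (b : Fin n → ZMod (p ^ ℓ)) :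
      fourierZp p n f (fun i ↦ zmodToAddCircle (p ^ ℓ) (b i)) =
        (((p ^ ℓ : ℕ) : ℂ) ^ n)⁻¹ * ∑ x, ZMod.stdAddChar (x ⬝ᵥ b) * F x := by
    simp_rw [fourierZp, pairingVec_zmodToAddCircle, eChar_zmodToAddCircle, hF]
    rw [integral_comp_of_surjective _ (reduceVec p n ℓ) (isLocallyConstant_reduceVec p n ℓ)
      (reduceVec_surjective p n ℓ) fun x ↦ ZMod.stdAddChar (x ⬝ᵥ b) * F x, hcard]
  have hright : ∫ z, ∫ t, f z * starRingEnd ℂ (f (z + t • u)) ∂(haarZp p) ∂(padicHaar p n) =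
      (((p ^ ℓ : ℕ) : ℂ) ^ n)⁻¹ * (((p ^ ℓ : ℕ) : ℂ)⁻¹ * ∑ z, ∑ t : ZMod (p ^ ℓ),
        F z * starRingEnd ℂ (F (z + t • reduceVec p n ℓ u))) := by
    have hsmul (t : ℤ_[p]) :
        reduceVec p n ℓ (t • u) = PadicInt.toZModPow ℓ t • reduceVec p n ℓ u :=
      funext fun i ↦ map_mul (PadicInt.toZModPow ℓ) t (u i)
    have hinner (z : Fin n → ℤ_[p]) :
        ∫ t, f z * starRingEnd ℂ (f (z + t • u)) ∂(haarZp p) =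
          ((p ^ ℓ : ℕ) : ℂ)⁻¹ * ∑ t : ZMod (p ^ ℓ), F (reduceVec p n ℓ z) *
            starRingEnd ℂ (F (reduceVec p n ℓ z + t • reduceVec p n ℓ u)) := by
      simp_rw [hF, map_add, hsmul]
      have := integral_comp_of_surjective (haarZp p)
        (PadicInt.toZModPow (p := p) ℓ).toAddMonoidHom (isLocallyConstant_toZModPow p ℓ)
        (toZModPow_surjective p ℓ) fun t ↦ F (reduceVec p n ℓ z) *
            starRingEnd ℂ (F (reduceVec p n ℓ z + t • reduceVec p n ℓ u))
      rwa [ZMod.card] at this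
    simp_rw [hinner]
    rw [integral_const_mul, integral_comp_of_surjective _ (reduceVec p n ℓ)
      (isLocallyConstant_reduceVec p n ℓ) (reduceVec_surjective p n ℓ) fun z ↦
        ∑ t : ZMod (p ^ ℓ), F z * starRingEnd ℂ (F (z + t • reduceVec p n ℓ u)), hcard]
    ring
  set S : Set (Fin n → AddCircle (1 : ℚ)) :=
    {a | (∀ i, ∃ m : ℕ, p ^ m • a i = 0) ∧ pairingVec p n u a = 0} with hS
  have hinj : Function.Injective
      fun (b : Fin n → ZMod (p ^ ℓ)) i ↦ zmodToAddCircle (p ^ ℓ) (b i) :=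
    (zmodToAddCircle_injective (p ^ ℓ)).comp_left
  have hsupp : Function.support (S.indicator fun a ↦ ‖fourierZp p n f a‖ ^ 2) ⊆
      Set.range fun (b : Fin n → ZMod (p ^ ℓ)) i ↦ zmodToAddCircle (p ^ ℓ) (b i) := by
    intro a ha
    obtain ⟨haS, hne⟩ := Set.indicator_apply_ne_zero.1 ha
    have htors (i : Fin n) : p ^ ℓ • a i = 0 := by
      by_contra hi
      exact hne (by simp [fourierZp_eq_zero hf haS.1 hi])
    choose b hb using fun i ↦ exists_zmodToAddCircle_eq (htors i)
    exact ⟨b, funext hb⟩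
  have hmem (b : Fin n → ZMod (p ^ ℓ)) :
      (fun i ↦ zmodToAddCircle (p ^ ℓ) (b i)) ∈ S ↔ reduceVec p n ℓ u ⬝ᵥ b = 0 := by
    rw [hS, Set.mem_ofPred_eq, pairingVec_zmodToAddCircle,
      map_eq_zero_iff _ (zmodToAddCircle_injective _)]
    exact and_iff_right fun i ↦ ⟨ℓ, nsmul_zmodToAddCircle _ _⟩
  have htsum : ∑' a : S, ‖fourierZp p n f a.1‖ ^ 2 =
      ∑ b, if reduceVec p n ℓ u ⬝ᵥ b = 0 then
        ‖fourierZp p n f (fun i ↦ zmodToAddCircle (p ^ ℓ) (b i))‖ ^ 2 else 0 := by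
    classical
    rw [tsum_subtype S fun a ↦ ‖fourierZp p n f a‖ ^ 2, ← hinj.tsum_eq hsupp, tsum_fintype]
    simp_rw [Set.indicator_apply, hmem]
  refine (congrArg Complex.ofReal htsum).trans ?_
  have hscale (b : Fin n → ZMod (p ^ ℓ)) :
      ((if reduceVec p n ℓ u ⬝ᵥ b = 0 then
        ‖fourierZp p n f (fun i ↦ zmodToAddCircle (p ^ ℓ) (b i))‖ ^ 2 else 0 : ℝ) : ℂ) =
      ((((p ^ ℓ : ℕ) : ℂ) ^ n)⁻¹) ^ 2 * (if reduceVec p n ℓ u ⬝ᵥ b = 0 then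
        ((‖∑ x, ZMod.stdAddChar (x ⬝ᵥ b) * F x‖ ^ 2 : ℝ) : ℂ) else 0) := by
    split_ifs
    · rw [hfourier, norm_mul, mul_pow]
      simp
    · simp
  rw [Complex.ofReal_sum, hright, Finset.sum_congr rfl fun b _ ↦ hscale b, ← Finset.mul_sum,
    sum_orthogonal_norm_sq]
  field_simp

end
end

section
/- Let $n \geq 2$ and $p$ a prime. There is a constant $C_n > 0$ (depending only on $n$ and $p$) such that for every measurable $f : \mathbb{Z}_p^n \to \mathbb{C}$, $C_n \int_{U \in \mathrm{Gr}(\mathbb{Z}_p^n, 2)} |\mathcal{N}^2 f(U)|^{n-1}\, d\nu \leq \int_{\mathbb{Z}_p^n} |f|^{n-1}\, d\mu$, where $\mathcal{N}^2 f(U) = \sup_{a \in \mathbb{Z}_p^n} \int_{x \in U} |f(a + x)|\, d\mu_U$. -/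
open MeasureTheory ENNReal

noncomputable section

/-- The Haar probability measure on the space of `2 × n` matrices over `ℤ_p`. -/
def matHaar (p : ℕ) [Fact p.Prime] (n : ℕ) : Measure (Fin 2 → Fin n → ℤ_[p]) :=
  Measure.addHaarMeasure ⟨⟨Set.univ, isCompact_univ⟩, by simp⟩

/-- A `2 × n` matrix over `ℤ_p` has a unit `2 × 2` minor; its rows then span a rank-2
free direct summand of `ℤ_p^n`, i.e. an element of `Gr(ℤ_p^n, 2)`. -/
def unitMinor (p : ℕ) [Fact p.Prime] (n : ℕ) (g : Fin 2 → Fin n → ℤ_[p]) : Prop :=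
  ∃ i j : Fin n, IsUnit (g 0 i * g 1 j - g 0 j * g 1 i)

/-- `Gr(ℤ_p^n, 2)`, parametrized by `2 × n` matrices with a unit `2 × 2` minor (the maps
below depend only on the submodule spanned by the rows). -/
def grSet (p : ℕ) [Fact p.Prime] (n : ℕ) : Set (Fin 2 → Fin n → ℤ_[p]) :=
  {g | unitMinor p n g}

/-- The normalized measure `ν` on `Gr(ℤ_p^n, 2)` induced by Haar measure: the normalized
restriction of Haar measure on matrix space to matrices with a unit `2 × 2` minor. -/
def grMeasure (p : ℕ) [Fact p.Prime] (n : ℕ) : Measure (Fin 2 → Fin n → ℤ_[p]) :=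
  (matHaar p n (grSet p n))⁻¹ • (matHaar p n).restrict (grSet p n)

/-- The maximal 2-plane operator: `𝒩² f (U) = sup_a ∫_{x ∈ U} f(a + x) dμ_U`, where the
2-plane `U` is spanned by the rows of `g` and `μ_U` is its Haar probability measure,
parametrized by `(s₀, s₁) ↦ s₀ g₀ + s₁ g₁`. -/
def maxOp2 (p : ℕ) [Fact p.Prime] (n : ℕ) (f : (Fin n → ℤ_[p]) → ℝ≥0∞)
    (g : Fin 2 → Fin n → ℤ_[p]) : ℝ≥0∞ :=
  ⨆ a : Fin n → ℤ_[p],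
    ∫⁻ s : Fin 2 → ℤ_[p], f (fun j => a j + s 0 * g 0 j + s 1 * g 1 j) ∂(padicHaar p 2)

section Interpolation

open Finset

variable {F : Type*} [Field F] {p : ℕ} [Fact p.Prime] [CharP F p]

open PowerSeries in
theorem one_add_X_pow_sub_one_dvd {t J : ℕ} (ht : 0 < t) (htJ : t < p ^ J) :
    ((1 + X : F⟦X⟧) ^ t - 1) ∣
      X ^ (∑ i ∈ range J, if p ^ i ∣ t then p ^ i else 0) := by
  have hp : p.Prime := Fact.out
  have : CharP F⟦X⟧ p := charP_of_injective_algebraMap (algebraMap F F⟦X⟧).injective p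
  obtain ⟨v, r, hr, rfl⟩ := Nat.exists_eq_pow_mul_and_not_dvd ht.ne' p hp.ne_one
  have hvJ : v < J := by
    by_contra! h
    have h1 : p ^ J ≤ p ^ v := Nat.pow_le_pow_right hp.pos h
    have h2 : p ^ v ≤ p ^ v * r := Nat.le_mul_of_pos_right _ (Nat.pos_of_ne_zero (by
      rintro rfl; simp at hr))
    omega
  have hunit : IsUnit (∑ i ∈ range r, (1 + X : F⟦X⟧) ^ i) := by
    rw [PowerSeries.isUnit_iff_constantCoeff]
    simp only [map_sum, map_pow, map_add, map_one, PowerSeries.constantCoeff_X, add_zero, one_pow,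
      sum_const, card_range, nsmul_eq_mul, mul_one, isUnit_iff_ne_zero]
    rwa [Ne, CharP.cast_eq_zero_iff F p]
  have h1 : (1 + X : F⟦X⟧) ^ (p ^ v * r) - 1 =
      (∑ i ∈ range r, (1 + X : F⟦X⟧) ^ i) ^ p ^ v * X ^ p ^ v := by
    rw [← mul_pow, mul_comm (p ^ v), pow_mul]
    have := sub_pow_char_pow (R := F⟦X⟧) (p := p) (n := v) ((1 + X) ^ r) 1
    rw [one_pow] at this
    rw [← this]
    congr 1
    have := geom_sum_mul (1 + X : F⟦X⟧) r
    rw [← this]; ring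
  rw [h1, (hunit.pow _).mul_left_dvd]
  apply pow_dvd_pow
  refine le_trans ?_ (single_le_sum (f := fun i => if p ^ i ∣ p ^ v * r then p ^ i else 0)
    (fun _ _ => Nat.zero_le _) (mem_range.2 hvJ))
  simp

open PowerSeries in
theorem one_add_X_pow_sub_pow_dvd {s t J : ℕ} (hst : s ≠ t) (hs : s < p ^ J) (ht : t < p ^ J) :
    ((1 + X : F⟦X⟧) ^ t - (1 + X) ^ s) ∣
      X ^ (∑ i ∈ range J, if s ≡ t [MOD p ^ i] then p ^ i else 0) := by
  have hunit : ∀ k : ℕ, IsUnit ((1 + X : F⟦X⟧) ^ k) := fun k => by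
    refine IsUnit.pow _ ?_
    rw [PowerSeries.isUnit_iff_constantCoeff]
    simp
  wlog h : s < t generalizing s t
  · have h2 := this hst.symm ht hs (by omega)
    rw [← neg_sub, neg_dvd]
    simpa only [Nat.ModEq.comm] using h2
  have h1 : ((1 + X : F⟦X⟧) ^ t - (1 + X) ^ s) = (1 + X) ^ s * ((1 + X) ^ (t - s) - 1) := by
    rw [mul_sub, ← pow_add, Nat.add_sub_cancel' h.le, mul_one]
  rw [h1, (hunit s).mul_left_dvd]
  convert one_add_X_pow_sub_one_dvd (F := F) (p := p) (t := t - s) (J := J) (by omega) (by omega)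
    using 5
  exact Nat.modEq_iff_dvd' h.le

open PowerSeries in
theorem prod_one_add_X_pow_sub_pow_dvd {J : ℕ} (u : Fin (p ^ J)) :
    (∏ s ∈ univ.erase u, ((1 + X : F⟦X⟧) ^ (u : ℕ) - (1 + X) ^ (s : ℕ))) ∣ X ^ (J * p ^ J) := by
  have hp : p.Prime := Fact.out
  calc _ ∣ ∏ s ∈ univ.erase u,
        (X : F⟦X⟧) ^ (∑ i ∈ range J, if (s : ℕ) ≡ u [MOD p ^ i] then p ^ i else 0) :=
        prod_dvd_prod_of_dvd _ _ fun s hs => one_add_X_pow_sub_pow_dvd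
          (fun h => (mem_erase.1 hs).1 (Fin.ext h)) s.2 u.2
    _ ∣ _ := by
      rw [prod_pow_eq_pow_sum]
      apply pow_dvd_pow
      calc _ ≤ ∑ s : Fin (p ^ J), ∑ i ∈ range J,
            (if (s : ℕ) ≡ u [MOD p ^ i] then p ^ i else 0) :=
            sum_le_sum_of_subset (erase_subset _ _)
        _ = ∑ i ∈ range J, ∑ s : Fin (p ^ J),
            (if (s : ℕ) ≡ u [MOD p ^ i] then p ^ i else 0) := sum_comm
        _ = ∑ i ∈ range J, p ^ J := by
          refine sum_congr rfl fun i hi => ?_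
          rw [Fin.sum_univ_eq_sum_range (fun s => if s ≡ u [MOD p ^ i] then p ^ i else 0),
            ← sum_filter, sum_const, ← Nat.count_eq_card_filter_range,
            Nat.count_modEq_card _ (pow_pos hp.pos i)]
          have hd : p ^ i ∣ p ^ J := pow_dvd_pow _ (mem_range.1 hi).le
          rw [Nat.mod_eq_zero_of_dvd hd]
          simp [Nat.div_mul_cancel hd]
        _ = _ := by simp

open PowerSeries in
theorem X_pow_dvd_of_eval (J V : ℕ) (c : Fin (p ^ J) → F⟦X⟧)
    (h : ∀ u : Fin (p ^ J), X ^ (V + J * p ^ J) ∣ ∑ a, c a * (1 + X) ^ ((u : ℕ) * a)) (a) :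
    X ^ V ∣ c a := by
  classical
  have hp : p.Prime := Fact.out
  have hdpos : 0 < p ^ J := pow_pos hp.pos J
  set z : Fin (p ^ J) → F⟦X⟧ := fun u => (1 + X) ^ (u : ℕ) with hz
  set P : Polynomial F⟦X⟧ := ∑ a : Fin (p ^ J), Polynomial.C (c a) * Polynomial.X ^ (a : ℕ) with hP
  have hPeval : ∀ u, P.eval (z u) = ∑ a, c a * (1 + X) ^ ((u : ℕ) * a) := fun u => by
    simp [hP, Polynomial.eval_finsetSum, hz, pow_mul]
  have hPcoeff : P.coeff a = c a := by
    simp only [hP, Polynomial.finsetSum_coeff, Polynomial.coeff_C_mul, Polynomial.coeff_X_pow]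
    rw [sum_eq_single a]
    · simp
    · intro b _ hb
      rw [if_neg (fun h => hb (Fin.ext h.symm)), mul_zero]
    · simp
  choose D hD using fun u : Fin (p ^ J) => prod_one_add_X_pow_sub_pow_dvd (F := F) (p := p) u
  choose v hv using h
  set L : Fin (p ^ J) → Polynomial F⟦X⟧ := fun u =>
    ∏ s ∈ univ.erase u, (Polynomial.X - Polynomial.C (z s)) with hL
  have hLself : ∀ u, (L u).eval (z u) * D u = X ^ (J * p ^ J) := fun u => by
    rw [hD u, hL, Polynomial.eval_prod]
    simp only [hz, Polynomial.eval_sub, Polynomial.eval_X, Polynomial.eval_C]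
  have hLne : ∀ u s, s ≠ u → (L u).eval (z s) = 0 := fun u s hsu => by
    rw [hL, Polynomial.eval_prod]
    exact prod_eq_zero (mem_erase.2 ⟨hsu, mem_univ _⟩) (by simp)
  have hzinj : Function.Injective z := fun s t hst => by
    by_contra hne
    have h1 := one_add_X_pow_sub_pow_dvd (F := F) (p := p) (fun h => hne (Fin.ext h)) s.2 t.2
    rw [show (1 + X : F⟦X⟧) ^ (t : ℕ) - (1 + X) ^ (s : ℕ) = 0 from sub_eq_zero.2 hst.symm,
      zero_dvd_iff] at h1
    exact pow_ne_zero _ PowerSeries.X_ne_zero h1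
  have key : Polynomial.C (X ^ (J * p ^ J)) * P =
      ∑ u, Polynomial.C (P.eval (z u) * D u) * L u := by
    rw [← sub_eq_zero]
    refine Polynomial.eq_zero_of_natDegree_lt_card_of_eval_eq_zero _ hzinj (fun u => ?_) ?_
    · rw [Polynomial.eval_sub, Polynomial.eval_finsetSum, sum_eq_single u]
      · simp only [Polynomial.eval_mul, Polynomial.eval_C]
        rw [← hLself u]; ring
      · intro s _ hs
        simp [hLne s u hs.symm]
      · simp
    · rw [Fintype.card_fin]
      refine lt_of_le_of_lt ?_ (Nat.sub_lt hdpos one_pos)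
      refine (Polynomial.natDegree_sub_le _ _).trans (max_le ?_ ?_)
      · refine (Polynomial.natDegree_C_mul_le _ _).trans ?_
        refine Polynomial.natDegree_sum_le_of_forall_le _ _ fun a _ => ?_
        exact (Polynomial.natDegree_C_mul_X_pow_le _ _).trans (by omega)
      · refine Polynomial.natDegree_sum_le_of_forall_le _ _ fun u _ => ?_
        refine (Polynomial.natDegree_C_mul_le _ _).trans ?_
        refine (Polynomial.natDegree_prod_le _ _).trans ?_
        simp
  have h1 := congrArg (fun Q => Polynomial.coeff Q a) key
  simp only [Polynomial.coeff_C_mul, Polynomial.finsetSum_coeff, hPcoeff] at h1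
  have h2 : X ^ (J * p ^ J) * X ^ V ∣ X ^ (J * p ^ J) * c a := by
    rw [h1]
    refine dvd_sum fun u _ => ?_
    rw [hPeval, hv u, pow_add]
    exact ⟨v u * D u * (L u).coeff a, by ring⟩
  exact (mul_dvd_mul_iff_left (pow_ne_zero _ PowerSeries.X_ne_zero)).1 h2

open PowerSeries in
theorem X_pow_dvd_of_eval_pi (m J V : ℕ) (c : (Fin m → Fin (p ^ J)) → F⟦X⟧)
    (h : ∀ u : Fin m → Fin (p ^ J),
      X ^ (V + m * (J * p ^ J)) ∣ ∑ α, c α * (1 + X) ^ (∑ i, (u i : ℕ) * α i)) (α) :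
    X ^ V ∣ c α := by
  induction m generalizing V with
  | zero =>
    have := h α
    rw [Fintype.sum_subsingleton _ α] at this
    simpa only [Fin.sum_univ_zero, zero_mul, add_zero, pow_zero, mul_one] using this
  | succ m ih =>
    have hsplit : ∀ g : (Fin (m + 1) → Fin (p ^ J)) → F⟦X⟧,
        ∑ α, g α = ∑ α : Fin m → Fin (p ^ J), ∑ a, g (Fin.cons a α) := fun g => by
      rw [← (Fin.consEquiv fun _ => Fin (p ^ J)).sum_comp, Fintype.sum_prod_type_right]
      rfl
    have hc := Fin.cons_self_tail α
    rw [← hc]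
    refine X_pow_dvd_of_eval (p := p) J V (fun a => c (Fin.cons a (Fin.tail α))) (fun u0 => ?_) _
    refine ih (V + J * p ^ J) (fun α' => ∑ a, c (Fin.cons a α') * (1 + X) ^ ((u0 : ℕ) * a))
      (fun u => ?_) (Fin.tail α)
    have := h (Fin.cons u0 u)
    rw [hsplit] at this
    convert this using 1
    · congr 1; ring
    · refine sum_congr rfl fun α' _ => ?_
      rw [sum_mul]
      refine sum_congr rfl fun a _ => ?_
      simp only [Fin.sum_univ_succ, Fin.cons_zero, Fin.cons_succ, pow_add]
      ring

open PowerSeries in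
theorem eq_zero_of_X_pow_dvd_eval (q J : ℕ) (c : (Fin (q + 1) → Fin (p ^ J)) → F)
    (h : ∀ u : Fin q → Fin (p ^ J), X ^ (p ^ J + q * (J * p ^ J)) ∣
      ∑ α, (C (c α) : F⟦X⟧) * (1 + X) ^ ((α 0 : ℕ) + ∑ i, (u i : ℕ) * α (Fin.succ i))) :
    c = 0 := by
  classical
  have hsplit : ∀ g : (Fin (q + 1) → Fin (p ^ J)) → F⟦X⟧,
      ∑ α, g α = ∑ α : Fin q → Fin (p ^ J), ∑ a, g (Fin.cons a α) := fun g => by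
    rw [← (Fin.consEquiv fun _ => Fin (p ^ J)).sum_comp, Fintype.sum_prod_type_right]
    rfl
  have h1 := X_pow_dvd_of_eval_pi (p := p) q J (p ^ J)
    (fun α => ∑ a, (C (c (Fin.cons a α)) : F⟦X⟧) * (1 + X) ^ (a : ℕ)) (fun u => by
      have := h u
      rw [hsplit] at this
      convert this using 1
      refine sum_congr rfl fun α' _ => ?_
      rw [sum_mul]
      refine sum_congr rfl fun a _ => ?_
      simp only [Fin.cons_zero, Fin.cons_succ, pow_add]
      ring)
  ext α
  have h2 := h1 (Fin.tail α)
  set P : Polynomial F := ∑ a : Fin (p ^ J),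
    Polynomial.C (c (Fin.cons a (Fin.tail α))) * Polynomial.X ^ (a : ℕ) with hP
  have h3 : ((P.comp (1 + Polynomial.X) : Polynomial F) : F⟦X⟧) =
      ∑ a, (C (c (Fin.cons a (Fin.tail α))) : F⟦X⟧) * (1 + X) ^ (a : ℕ) := by
    rw [hP, ← Polynomial.coeToPowerSeries.ringHom_apply]
    simp [Polynomial.sum_comp]
  have hdeg : P.natDegree < p ^ J := by
    have hp : p.Prime := Fact.out
    refine lt_of_le_of_lt ?_ (Nat.sub_lt (pow_pos hp.pos J) one_pos)
    refine Polynomial.natDegree_sum_le_of_forall_le _ _ fun a _ => ?_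
    exact (Polynomial.natDegree_C_mul_X_pow_le _ _).trans (by omega)
  have h4 : P.comp (1 + Polynomial.X) = 0 := by
    rw [← h3, PowerSeries.X_pow_dvd_iff] at h2
    ext i
    by_cases hi : i < p ^ J
    · simpa [Polynomial.coeff_coe] using h2 i hi
    · rw [Polynomial.coeff_zero]
      refine Polynomial.coeff_eq_zero_of_natDegree_lt ?_
      rw [Polynomial.natDegree_comp, add_comm, ← Polynomial.C_1, Polynomial.natDegree_X_add_C]
      omega
  have h5 : P = 0 := by
    have := congrArg (fun Q => Polynomial.comp Q (Polynomial.X - 1)) h4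
    simpa [Polynomial.comp_assoc] using this
  have h6 := congrArg (fun Q => Polynomial.coeff Q (α 0 : ℕ)) h5
  simp only [hP, Polynomial.finsetSum_coeff, Polynomial.coeff_C_mul, Polynomial.coeff_X_pow,
    Polynomial.coeff_zero] at h6
  rw [sum_eq_single (α 0)] at h6
  · simpa [Fin.cons_self_tail] using h6
  · intro b _ hb
    rw [if_neg (fun h => hb (Fin.ext h.symm)), mul_zero]
  · simp

end Interpolation

section Vanishing

open MvPolynomial in
theorem pow_dvd_aeval_of_coeff_eq_zero {σ L : Type*} [Fintype σ] [CommRing L]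
    (Q : MvPolynomial σ L) (ξ : σ → L) (w : ℕ)
    (hQ : ∀ β : σ →₀ ℕ, (∀ i, β i < w) → coeff β (aeval (fun i => X i + C (ξ i)) Q) = 0)
    (Y : σ → Polynomial L) (P : Polynomial L) (hY : ∀ i, P ∣ Y i - Polynomial.C (ξ i)) :
    P ^ w ∣ aeval Y Q := by
  have h1 : aeval Y Q = aeval (fun i => Y i - Polynomial.C (ξ i))
      (aeval (fun i => X i + C (ξ i) : σ → MvPolynomial σ L) Q) := by
    rw [← AlgHom.comp_apply]
    congr 1
    ext i : 1
    simp only [aeval_X, AlgHom.comp_apply, map_add]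
    rw [← algebraMap_eq, AlgHom.commutes, Polynomial.algebraMap_eq, sub_add_cancel]
  rw [h1, aeval_def, eval₂_eq']
  refine Finset.dvd_sum fun β _ => ?_
  by_cases hβ : ∀ i, β i < w
  · rw [hQ β hβ, map_zero, zero_mul]
    exact dvd_zero _
  · push Not at hβ
    obtain ⟨i, hi⟩ := hβ
    refine Dvd.dvd.mul_left ?_ _
    calc P ^ w ∣ P ^ β i := pow_dvd_pow _ hi
      _ ∣ (Y i - Polynomial.C (ξ i)) ^ β i := pow_dvd_pow_of_dvd (hY i) _
      _ ∣ _ := Finset.dvd_prod_of_mem (fun i => (Y i - Polynomial.C (ξ i)) ^ β i)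
        (Finset.mem_univ i)

/-- The polynomial with degree less than `d` in each variable and given coefficients. -/
noncomputable def boxPoly {σ L : Type*} [Fintype σ] [DecidableEq σ] [CommSemiring L] {d : ℕ}
    (c : (σ → Fin d) → L) : MvPolynomial σ L :=
  ∑ α, MvPolynomial.C (c α) * ∏ i, MvPolynomial.X i ^ (α i : ℕ)

theorem aeval_boxPoly {σ L A : Type*} [Fintype σ] [DecidableEq σ] [CommSemiring L] [CommSemiring A] [Algebra L A]
    {d : ℕ} (c : (σ → Fin d) → L) (Y : σ → A) :
    MvPolynomial.aeval Y (boxPoly c) = ∑ α, algebraMap L A (c α) * ∏ i, Y i ^ (α i : ℕ) := by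
  simp [boxPoly]

/-- Fewer vanishing conditions than coefficients: a nonzero polynomial of degree less than `d` in
each variable vanishes to prescribed order `w x` at points `ξ x`. -/
theorem exists_boxPoly_vanishing {σ L ι : Type*} [Fintype σ] [DecidableEq σ] [Field L] [Fintype ι]
    (d : ℕ) (ξ : ι → σ → L) (w : ι → ℕ)
    (hlt : ∑ x, w x ^ Fintype.card σ < d ^ Fintype.card σ) :
    ∃ c : (σ → Fin d) → L, c ≠ 0 ∧ ∀ x, ∀ β : σ →₀ ℕ, (∀ i, β i < w x) →
      MvPolynomial.coeff β (MvPolynomial.aeval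
        (fun i => MvPolynomial.X i + MvPolynomial.C (ξ x i)) (boxPoly c)) = 0 := by
  let Φ : ((σ → Fin d) → L) →ₗ[L] ((Σ x, σ → Fin (w x)) → L) :=
    { toFun := fun c y => MvPolynomial.coeff (Finsupp.equivFunOnFinite.symm fun i => (y.2 i : ℕ))
        (MvPolynomial.aeval (fun i => MvPolynomial.X i + MvPolynomial.C (ξ y.1 i))
          (boxPoly c))
      map_add' := fun c c' => by
        ext y
        simp [boxPoly, add_mul, Finset.sum_add_distrib]
      map_smul' := fun r c => by
        ext y
        simp only [boxPoly, Pi.smul_apply, smul_eq_mul, map_mul, mul_assoc, RingHom.id_apply]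
        rw [← Finset.mul_sum, map_mul, ← MvPolynomial.algebraMap_eq, AlgHom.commutes,
          MvPolynomial.algebraMap_eq, MvPolynomial.coeff_C_mul] }
  have hker : LinearMap.ker Φ ≠ ⊥ := by
    apply LinearMap.ker_ne_bot_of_finrank_lt
    simpa using hlt
  obtain ⟨c, hc, hc0⟩ := (Submodule.ne_bot_iff _).1 hker
  refine ⟨c, hc0, fun x β hβ => ?_⟩
  have := congrFun (LinearMap.mem_ker.1 hc) ⟨x, fun i => ⟨β i, hβ i⟩⟩
  have hβ' : (Finsupp.equivFunOnFinite.symm fun i => β i) = β := by ext; simp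
  rw [← hβ']
  exact this

theorem ValuationSubring.exists_smul_mem {L ι : Type*} [Field L] [Fintype ι]
    (O : ValuationSubring L) (c : ι → L) (hc : c ≠ 0) :
    ∃ (r : L) (c' : ι → O), (∀ i, (c' i : L) = r * c i) ∧ ∃ i, c' i = 1 := by
  classical
  obtain ⟨i₁, hi₁⟩ := Function.ne_iff.1 hc
  obtain ⟨i₀, -, hi₀⟩ := Finset.exists_max_image Finset.univ (fun i => O.valuation (c i))
    ⟨i₁, Finset.mem_univ _⟩
  have h0 : c i₀ ≠ 0 := fun h => by
    have := hi₀ i₁ (Finset.mem_univ _)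
    simp only [h, map_zero, le_zero_iff, map_eq_zero] at this
    exact hi₁ this
  refine ⟨(c i₀)⁻¹, fun i => ⟨(c i₀)⁻¹ * c i, ?_⟩, fun i => rfl, i₀, ?_⟩
  · rw [← O.valuation_le_one_iff, map_mul, map_inv₀, mul_comm, ← div_eq_mul_inv]
    exact div_le_one_of_le₀ (hi₀ i (Finset.mem_univ _)) zero_le
  · ext
    simp [h0]

open Finset in
theorem pow_le_sum_pow_of_rich_lines {L : Type*} [Field L] (O : ValuationSubring L) {p : ℕ}
    [Fact p.Prime] [CharP (IsLocalRing.ResidueField O) p] {N : ℕ} [NeZero N] (ζ : O)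
    (hζ : IsPrimitiveRoot (ζ : L) N) (hres : IsLocalRing.residue O ζ = 1) (q J r : ℕ)
    (w : (Fin (q + 1) → ZMod N) → ℕ) (hr : p ^ J + q * (J * p ^ J) ≤ r)
    (hw : ∀ b : Fin q → ZMod N, ∃ y : Fin (q + 1) → ZMod N,
      r ≤ ∑ t : ZMod N, w (y + t • (Fin.cons 1 b : Fin (q + 1) → ZMod N))) :
    (p ^ J) ^ (q + 1) ≤ ∑ x, w x ^ (q + 1) := by
  classical
  by_contra! hlt
  obtain ⟨c₀, hc₀, hvan₀⟩ := exists_boxPoly_vanishing (σ := Fin (q + 1)) (p ^ J)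
    (fun (x : Fin (q + 1) → ZMod N) i => (ζ : L) ^ (x i).val) w (by simpa using hlt)
  obtain ⟨s, c, hc, α₀, hα₀⟩ := O.exists_smul_mem c₀ hc₀
  have hvan : ∀ x, ∀ β : Fin (q + 1) →₀ ℕ, (∀ i, β i < w x) →
      MvPolynomial.coeff β (MvPolynomial.aeval
        (fun i => MvPolynomial.X i + MvPolynomial.C ((ζ : L) ^ (x i).val))
        (boxPoly fun α => (c α : L))) = 0 := fun x β hβ => by
    have h1 : (boxPoly fun α => (c α : L)) = MvPolynomial.C s * boxPoly c₀ := by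
      simp only [boxPoly, hc, map_mul, mul_assoc, Finset.mul_sum]
    rw [h1, map_mul, ← MvPolynomial.algebraMap_eq, AlgHom.commutes,
          MvPolynomial.algebraMap_eq, MvPolynomial.coeff_C_mul, hvan₀ x β hβ, mul_zero]
  have hzero : (fun α => IsLocalRing.residue O (c α)) = 0 := by
    refine eq_zero_of_X_pow_dvd_eval (p := p) q J _ fun u => ?_
    obtain ⟨y, hy⟩ := hw fun i => ((u i : ℕ) : ZMod N)
    set U : Fin (q + 1) → ℕ := Fin.cons 1 fun i => (u i : ℕ) with hU
    have hU' : (Fin.cons 1 fun i => ((u i : ℕ) : ZMod N)) = fun i => (U i : ZMod N) := by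
      funext i
      refine Fin.cases ?_ (fun i => ?_) i <;> simp [hU]
    rw [hU'] at hy
    set G : Polynomial O := ∑ α, Polynomial.C (c α) *
      ∏ i, (Polynomial.C (ζ ^ (y i).val) * Polynomial.X ^ U i) ^ (α i : ℕ) with hG
    set M : Polynomial O := ∏ t : ZMod N, (Polynomial.X - Polynomial.C (ζ ^ t.val)) ^
      w (y + t • fun i => (U i : ZMod N)) with hM
    have hMmonic : M.Monic :=
      Polynomial.monic_prod_of_monic _ _ fun t _ => (Polynomial.monic_X_sub_C _).pow _
    have hdvd : M ∣ G := by
      rw [← Polynomial.map_dvd_map O.subtype Subtype.val_injective hMmonic, hM,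
        Polynomial.map_prod]
      refine Finset.prod_dvd_of_coprime (fun t _ t' _ htt' => ?_) fun t _ => ?_
      · simp only [Polynomial.map_pow, Polynomial.map_sub, Polynomial.map_X, Polynomial.map_C,
          Function.onFun]
        refine IsCoprime.pow (Polynomial.isCoprime_X_sub_C_of_isUnit_sub ?_)
        rw [isUnit_iff_ne_zero, sub_ne_zero]
        intro h
        simp only [map_pow] at h
        exact htt' (ZMod.val_injective N (hζ.pow_inj (ZMod.val_lt t) (ZMod.val_lt t') h))
      · have h1 : G.map O.subtype = MvPolynomial.aeval
            (fun i => Polynomial.C ((ζ : L) ^ (y i).val) * Polynomial.X ^ U i)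
            (boxPoly fun α => (c α : L)) := by
          rw [aeval_boxPoly, hG, Polynomial.map_sum]
          simp [Polynomial.map_prod]
        rw [h1, Polynomial.map_pow]
        refine pow_dvd_aeval_of_coeff_eq_zero _ _ _ (hvan _) _ _ fun i => ?_
        simp only [Polynomial.map_sub, Polynomial.map_X, Polynomial.map_C]
        rw [Polynomial.dvd_iff_isRoot]
        simp only [Polynomial.IsRoot, Polynomial.eval_sub, Polynomial.eval_mul,
          Polynomial.eval_pow, Polynomial.eval_X, Polynomial.eval_C]
        rw [sub_eq_zero]
        simp only [map_pow, ValuationSubring.subtype_apply]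
        rw [← pow_mul, ← pow_add,
          (hζ.isOfFinOrder (NeZero.ne N)).pow_eq_pow_iff_modEq, ← hζ.eq_orderOf,
          ← ZMod.natCast_eq_natCast_iff]
        simp
    obtain ⟨H, hH⟩ := hdvd
    have h2 := congrArg (fun Q : Polynomial O => Polynomial.eval₂
      ((PowerSeries.C (R := IsLocalRing.ResidueField O)).comp (IsLocalRing.residue O))
      (1 + PowerSeries.X) Q) hH
    simp only [hG, hM, Polynomial.eval₂_finsetSum, Polynomial.eval₂_mul, Polynomial.eval₂_C,
      Polynomial.eval₂_finsetProd, Polynomial.eval₂_pow, Polynomial.eval₂_sub, Polynomial.eval₂_X,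
      RingHom.comp_apply, map_pow, hres, map_one, one_pow, one_mul, add_sub_cancel_left] at h2
    rw [Finset.prod_pow_eq_pow_sum] at h2
    refine (pow_dvd_pow _ (hr.trans hy)).trans ⟨_, Eq.trans ?_ h2⟩
    refine Finset.sum_congr rfl fun α _ => ?_
    congr 1
    simp only [← pow_mul, Finset.prod_pow_eq_pow_sum]
    congr 1
    simp [Fin.sum_univ_succ, hU]
  have := congrFun hzero α₀
  simp [hα₀] at this

theorem PadicAlgCl.exists_primitiveRoot (p : ℕ) [Fact p.Prime] (j : ℕ) :
    CharP (IsLocalRing.ResidueField (Valued.v (R := PadicAlgCl p)).valuationSubring) p ∧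
    ∃ ζ : (Valued.v (R := PadicAlgCl p)).valuationSubring,
      IsPrimitiveRoot (ζ : PadicAlgCl p) (p ^ j) ∧ IsLocalRing.residue _ ζ = 1 := by
  set O := (Valued.v (R := PadicAlgCl p)).valuationSubring
  have hp : p.Prime := Fact.out
  have hchar : CharP (IsLocalRing.ResidueField O) p := by
    rw [CharP.charP_iff_prime_eq_zero hp, ← map_natCast (IsLocalRing.residue O),
      IsLocalRing.residue_eq_zero_iff, IsLocalRing.mem_maximalIdeal, mem_nonunits_iff]
    intro hu
    obtain ⟨x, hx⟩ := hu.exists_right_inv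
    have h1 := congrArg (fun y : O => Valued.v (y : PadicAlgCl p)) hx
    have hx1 : Valued.v (x : PadicAlgCl p) ≤ 1 := x.2
    have hp1 : (1 : NNReal) < p := by exact_mod_cast hp.one_lt
    have h2 : Valued.v (x : PadicAlgCl p) = p := by
      simp only [MulMemClass.coe_mul, SubringClass.coe_natCast, map_mul, PadicAlgCl.valuation_p,
        OneMemClass.coe_one, map_one] at h1
      field_simp at h1
      exact h1
    exact absurd (h2 ▸ hx1) hp1.not_ge
  refine ⟨hchar, ?_⟩
  have : NeZero ((p ^ j : ℕ) : PadicAlgCl p) := ⟨by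
    rw [Nat.cast_ne_zero]; exact pow_ne_zero _ hp.ne_zero⟩
  obtain ⟨ζ, hζ⟩ := HasEnoughRootsOfUnity.exists_primitiveRoot (PadicAlgCl p) (p ^ j)
  have hmem : ζ ∈ O := by
    rw [Valuation.mem_valuationSubring_iff]
    have h1 := congrArg Valued.v hζ.pow_eq_one
    rw [map_pow, map_one] at h1
    exact ((pow_eq_one_iff_of_nonneg zero_le (pow_ne_zero _ hp.ne_zero)).1 h1).le
  refine ⟨⟨ζ, hmem⟩, hζ, ?_⟩
  have h1 : (⟨ζ, hmem⟩ : O) ^ p ^ j = 1 := Subtype.ext hζ.pow_eq_one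
  have h2 := congrArg (IsLocalRing.residue O) h1
  rw [map_pow, map_one] at h2
  have h3 := sub_pow_char_pow (p := p) (n := j) (IsLocalRing.residue O ⟨ζ, hmem⟩) 1
  rw [h2, one_pow, sub_self] at h3
  exact sub_eq_zero.1 (pow_eq_zero_iff (pow_ne_zero _ hp.ne_zero) |>.1 h3)

/-- Weighted Kakeya bound over `ℤ/p^j`: if every direction has a line of weight at least `r`, then
the weight is large in `ℓ^{q+1}`. -/
theorem kakeya_weighted_bound (p j q J r : ℕ) [Fact p.Prime]
    (w : (Fin (q + 1) → ZMod (p ^ j)) → ℕ) (hr : p ^ J + q * (J * p ^ J) ≤ r)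
    (hw : ∀ b : Fin q → ZMod (p ^ j), ∃ y : Fin (q + 1) → ZMod (p ^ j),
      r ≤ ∑ t : ZMod (p ^ j), w (y + t • (Fin.cons 1 b : Fin (q + 1) → ZMod (p ^ j)))) :
    (p ^ J) ^ (q + 1) ≤ ∑ x, w x ^ (q + 1) := by
  obtain ⟨hchar, ζ, hζ, hres⟩ := PadicAlgCl.exists_primitiveRoot p j
  exact pow_le_sum_pow_of_rich_lines _ ζ hζ hres q J r w hr hw

end Vanishing

section KakeyaStrong

open Finset

/-- Few translates of a dense set cover a finite abelian group. -/
theorem exists_card_uncovered_le {G : Type*} [AddCommGroup G] [Fintype G] [DecidableEq G]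
    (D : Finset G) (r : ℕ) : ∃ V : Finset G, #V ≤ r ∧
      (#{b | ∀ v ∈ V, b - v ∉ D} : ℝ) ≤ Fintype.card G * (1 - #D / Fintype.card G) ^ r := by
  induction r with
  | zero => exact ⟨∅, by simp⟩
  | succ r ih =>
    obtain ⟨V, hV, hE⟩ := ih
    set E : Finset G := {b | ∀ v ∈ V, b - v ∉ D}
    have hcard : (0 : ℝ) < Fintype.card G := by exact_mod_cast Fintype.card_pos
    have hsum : ∑ v : G, (#{b ∈ E | b - v ∉ D} : ℝ) =
        ∑ v : G, (#E * (1 - #D / Fintype.card G) : ℝ) := by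
      have h1 : ∀ b : G, #{v : G | b - v ∉ D} = Fintype.card G - #D := fun b => by
        rw [← card_compl]
        exact card_nbij' (fun v => b - v) (fun v => b - v) (fun v => by simp) (fun v => by simp)
          (fun v => by simp) (fun v => by simp)
      have h2 := sum_card_bipartiteAbove_eq_sum_card_bipartiteBelow (s := E) (t := univ)
        (fun b v : G => b - v ∉ D)
      simp only [bipartiteAbove, bipartiteBelow, h1] at h2
      have h3 : #D ≤ Fintype.card G := card_le_univ _
      rw [← Nat.cast_sum, ← h2]
      simp only [sum_const, smul_eq_mul, nsmul_eq_mul, card_univ, Nat.cast_mul]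
      rw [Nat.cast_sub h3]
      field_simp
    obtain ⟨v, -, hv⟩ := exists_le_of_sum_le (univ_nonempty) hsum.le
    refine ⟨insert v V, (card_insert_le _ _).trans (by omega), ?_⟩
    have h4 : ({b | ∀ u ∈ insert v V, b - u ∉ D} : Finset G) = {b ∈ E | b - v ∉ D} := by
      ext b
      simp [E, and_comm]
    have h5 : (0 : ℝ) ≤ 1 - #D / Fintype.card G := by
      rw [sub_nonneg, div_le_one hcard]
      exact_mod_cast card_le_univ _
    rw [h4, pow_succ, ← mul_assoc]
    exact hv.trans (mul_le_mul_of_nonneg_right hE h5)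

theorem exists_translates_cover {G : Type*} [AddCommGroup G] [Fintype G] [DecidableEq G]
    (D : Finset G) (hD : D.Nonempty) : ∃ V : Finset G, (∀ b, ∃ v ∈ V, b - v ∈ D) ∧
      (#V * #D : ℝ) ≤ Fintype.card G * (Real.log (Fintype.card G) + 1) := by
  have hcard : (0 : ℝ) < Fintype.card G := by exact_mod_cast Fintype.card_pos
  set δ : ℝ := #D / Fintype.card G with hδ
  have hδ0 : 0 < δ := div_pos (by exact_mod_cast hD.card_pos) hcard
  have hδ1 : δ ≤ 1 := by
    rw [hδ, div_le_one hcard]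
    exact_mod_cast card_le_univ _
  set r : ℕ := ⌊Real.log (Fintype.card G) / δ⌋₊ + 1 with hr
  have hlog : 0 ≤ Real.log (Fintype.card G) :=
    Real.log_nonneg (by exact_mod_cast Fintype.card_pos)
  have hr1 : Real.log (Fintype.card G) < δ * r := by
    have := Nat.lt_floor_add_one (Real.log (Fintype.card G) / δ)
    rw [div_lt_iff₀ hδ0] at this
    rw [hr]
    push_cast
    linarith
  have hr2 : δ * r ≤ Real.log (Fintype.card G) + 1 := by
    have := Nat.floor_le (div_nonneg hlog hδ0.le)
    rw [le_div_iff₀ hδ0] at this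
    rw [hr]
    push_cast
    linarith
  obtain ⟨V, hV, hE⟩ := exists_card_uncovered_le D r
  refine ⟨V, fun b => ?_, ?_⟩
  · have h1 : (1 - δ) ^ r ≤ Real.exp (-(δ * r)) := by
      rw [mul_comm, ← mul_neg, Real.exp_nat_mul]
      exact pow_le_pow_left₀ (by linarith) (Real.one_sub_le_exp_neg δ) _
    have h2 : Fintype.card G * Real.exp (-(δ * r)) < 1 := by
      rw [Real.exp_neg, ← div_eq_mul_inv, div_lt_one (Real.exp_pos _),
        ← Real.log_lt_iff_lt_exp hcard]
      exact hr1
    have h3 : (#{b | ∀ v ∈ V, b - v ∉ D} : ℝ) < 1 :=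
      (hE.trans (mul_le_mul_of_nonneg_left h1 hcard.le)).trans_lt h2
    have h4 : #{b | ∀ v ∈ V, b - v ∉ D} = 0 := by
      exact_mod_cast Nat.lt_one_iff.1 (by exact_mod_cast h3)
    rw [card_eq_zero, filter_eq_empty_iff] at h4
    simpa using h4 (mem_univ b)
  · calc (#V * #D : ℝ) ≤ r * #D := by gcongr
      _ = Fintype.card G * (δ * r) := by rw [hδ]; field_simp
      _ ≤ _ := by gcongr

theorem exists_pow_mul_le_lt {p : ℕ} (hp : 2 ≤ p) (q r : ℕ) (hr : 1 ≤ r) :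
    ∃ J, p ^ J * (q * J + 1) ≤ r ∧ r < p ^ (J + 1) * (q * (J + 1) + 1) := by
  classical
  have hex : ∃ J, r < p ^ J * (q * J + 1) :=
    ⟨r, (Nat.lt_pow_self (by omega)).trans_le (Nat.le_mul_of_pos_right _ (by omega))⟩
  have h0 : Nat.find hex ≠ 0 := fun h => by
    have := Nat.find_spec hex
    rw [h] at this
    simp at this
    omega
  obtain ⟨J, hJ⟩ := Nat.exists_eq_succ_of_ne_zero h0
  refine ⟨J, not_lt.1 (Nat.find_min hex (by omega)), ?_⟩
  have := Nat.find_spec hex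
  rwa [hJ] at this

theorem kakeya_weak (p q : ℕ) [Fact p.Prime] : ∃ C : ℝ, 0 < C ∧ ∀ (j : ℕ)
    (D : Finset (Fin q → ZMod (p ^ j))) (w : (Fin (q + 1) → ZMod (p ^ j)) → ℕ) (r : ℕ), 1 ≤ r →
    r ≤ p ^ (2 * j) →
    (∀ b ∈ D, ∃ y : Fin (q + 1) → ZMod (p ^ j),
      r ≤ ∑ t : ZMod (p ^ j), w (y + t • (Fin.cons 1 b : Fin (q + 1) → ZMod (p ^ j)))) →
    (#D * r ^ (q + 1) : ℝ) ≤
      C * (j + 1) ^ (q + 2) * (p ^ j) ^ q * ∑ x, (w x : ℝ) ^ (q + 1) := by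
  classical
  have hp : p.Prime := Fact.out
  have hp1 : (1 : ℝ) ≤ p := by exact_mod_cast hp.one_lt.le
  have hlogp : 0 ≤ Real.log p := Real.log_nonneg hp1
  refine ⟨(q * Real.log p + 1) * (p * (2 * q + 1)) ^ (q + 1), by positivity,
    fun j D w r hr hrj hD => ?_⟩
  rcases D.eq_empty_or_nonempty with rfl | hne
  · simp
    positivity
  obtain ⟨V, hVcov, hV⟩ := exists_translates_cover D hne
  obtain ⟨J, hJ1, hJ2⟩ := exists_pow_mul_le_lt hp.two_le q r hr
  have hJj : J ≤ 2 * j := by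
    rw [← Nat.pow_le_pow_iff_right hp.one_lt]
    exact ((Nat.le_mul_of_pos_right _ (by omega)).trans hJ1).trans hrj
  set W : (Fin (q + 1) → ZMod (p ^ j)) → ℕ := fun x =>
    V.sup fun v => w (x - x 0 • (Fin.cons 0 v : Fin (q + 1) → ZMod (p ^ j))) with hW
  have hshear : ∀ v : Fin q → ZMod (p ^ j), ∑ x : Fin (q + 1) → ZMod (p ^ j),
      w (x - x 0 • (Fin.cons 0 v : Fin (q + 1) → ZMod (p ^ j))) ^ (q + 1) =
      ∑ x, w x ^ (q + 1) := fun v => by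
    refine Fintype.sum_bijective
      (fun x => x - x 0 • (Fin.cons 0 v : Fin (q + 1) → ZMod (p ^ j))) ?_ _ _ fun x => rfl
    refine Function.bijective_iff_has_inverse.2
      ⟨fun x => x + x 0 • (Fin.cons 0 v : Fin (q + 1) → ZMod (p ^ j)), fun x => ?_, fun x => ?_⟩
    · simp
    · simp
  have hWsum : ∑ x, W x ^ (q + 1) ≤ #V * ∑ x, w x ^ (q + 1) := by
    calc ∑ x, W x ^ (q + 1) ≤ ∑ x, ∑ v ∈ V,
          w (x - x 0 • (Fin.cons 0 v : Fin (q + 1) → ZMod (p ^ j))) ^ (q + 1) := by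
          refine sum_le_sum fun x _ => ?_
          obtain ⟨v, hv, hvx⟩ := V.exists_mem_eq_sup (by
            obtain ⟨v, hv, -⟩ := hVcov 0
            exact ⟨v, hv⟩) fun v => w (x - x 0 • (Fin.cons 0 v : Fin (q + 1) → ZMod (p ^ j)))
          simp only [hW]
          rw [hvx]
          exact single_le_sum (f := fun v =>
            w (x - x 0 • (Fin.cons 0 v : Fin (q + 1) → ZMod (p ^ j))) ^ (q + 1))
            (fun _ _ => Nat.zero_le _) hv
      _ = #V * ∑ x, w x ^ (q + 1) := by
          rw [sum_comm, sum_congr rfl fun v _ => hshear v, sum_const, smul_eq_mul]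
  have hkak := kakeya_weighted_bound p j q J r W (by linarith [hJ1]) fun b => by
    obtain ⟨v, hv, hbv⟩ := hVcov b
    obtain ⟨y, hy⟩ := hD _ hbv
    refine ⟨y + y 0 • Fin.cons 0 v, hy.trans (sum_le_sum fun t _ => ?_)⟩
    refine le_trans (le_of_eq ?_) (le_sup (f := fun v =>
      w (_ - _ • (Fin.cons 0 v : Fin (q + 1) → ZMod (p ^ j)))) hv)
    congr 1
    ext i
    refine Fin.cases ?_ (fun i => ?_) i
    · simp
    · simp
      ring
  have h1 : ((p : ℝ) ^ J) ^ (q + 1) ≤ #V * ∑ x, (w x : ℝ) ^ (q + 1) := by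
    exact_mod_cast hkak.trans hWsum
  have h2 : (r : ℝ) ≤ p ^ J * ((p * (2 * q + 1)) * (j + 1)) := by
    have h3 : (r : ℝ) ≤ p ^ (J + 1) * (q * (J + 1) + 1) := by exact_mod_cast hJ2.le
    have h4 : (J : ℝ) ≤ 2 * j := by exact_mod_cast hJj
    calc (r : ℝ) ≤ p ^ (J + 1) * (q * (J + 1) + 1) := h3
      _ ≤ p ^ (J + 1) * (q * (2 * j + 1) + 1) := by gcongr
      _ ≤ p ^ (J + 1) * ((2 * q + 1) * (j + 1)) := by
          gcongr
          have : (0 : ℝ) ≤ j := by positivity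
          have : (0 : ℝ) ≤ q := by positivity
          nlinarith
      _ = _ := by ring
  have hG : (Fintype.card (Fin q → ZMod (p ^ j)) : ℝ) = (p ^ j) ^ q := by
    simp [ZMod.card]
  have hlog : Real.log (Fintype.card (Fin q → ZMod (p ^ j))) + 1 ≤
      (q * Real.log p + 1) * (j + 1) := by
    rw [hG, Real.log_pow, Real.log_pow]
    have : 0 ≤ (q : ℝ) * Real.log p := by positivity
    have : (0 : ℝ) ≤ j := by positivity
    nlinarith
  calc (#D * r ^ (q + 1) : ℝ)
      ≤ #D * (p ^ J * ((p * (2 * q + 1)) * (j + 1))) ^ (q + 1) := by gcongr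
    _ = #D * ((p * (2 * q + 1)) * (j + 1)) ^ (q + 1) * (p ^ J) ^ (q + 1) := by
        rw [mul_pow]; ring
    _ ≤ #D * ((p * (2 * q + 1)) * (j + 1)) ^ (q + 1) * (#V * ∑ x, (w x : ℝ) ^ (q + 1)) := by
        gcongr
    _ = (#V * #D) * (((p * (2 * q + 1)) * (j + 1)) ^ (q + 1) * ∑ x, (w x : ℝ) ^ (q + 1)) := by
        ring
    _ ≤ ((p ^ j) ^ q * ((q * Real.log p + 1) * (j + 1))) *
        (((p * (2 * q + 1)) * (j + 1)) ^ (q + 1) * ∑ x, (w x : ℝ) ^ (q + 1)) := by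
        refine mul_le_mul_of_nonneg_right ?_ (by positivity)
        rw [← hG]
        exact hV.trans (by gcongr)
    _ = _ := by rw [mul_pow _ ((j : ℝ) + 1)]; ring

/-- Kakeya maximal inequality over `ℤ/p^j` with polynomial loss in `j`. -/
theorem kakeya_strong (p q : ℕ) [Fact p.Prime] : ∃ C : ℝ, 0 < C ∧ ∀ (j : ℕ)
    (w : (Fin (q + 1) → ZMod (p ^ j)) → ℝ) (M : (Fin q → ZMod (p ^ j)) → ℝ),
    (∀ x, 0 ≤ w x) → (∀ b, 0 ≤ M b) →
    (∀ b, ∃ y : Fin (q + 1) → ZMod (p ^ j),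
      M b ≤ ∑ t : ZMod (p ^ j), w (y + t • (Fin.cons 1 b : Fin (q + 1) → ZMod (p ^ j)))) →
    ∑ b, M b ^ (q + 1) ≤ C * (j + 1) ^ (q + 3) * (p ^ j) ^ q * ∑ x, w x ^ (q + 1) := by
  classical
  have hp : p.Prime := Fact.out
  have hp1 : (1 : ℝ) ≤ p := by exact_mod_cast hp.one_lt.le
  obtain ⟨C, hC, hweak⟩ := kakeya_weak p q
  refine ⟨1 + (2 * p + 1) * (4 ^ (q + 1) * C), by positivity, fun j w M hw hM0 hM => ?_⟩
  have hN : (1 : ℝ) ≤ p ^ j := one_le_pow₀ hp1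
  rcases (sum_nonneg fun x _ => pow_nonneg (hw x) (q + 1) : 0 ≤ ∑ x, w x ^ (q + 1)).eq_or_lt
    with h0 | hpos
  · have hw0 : ∀ x, w x = 0 := fun x => by
      have := (sum_eq_zero_iff_of_nonneg fun x _ => pow_nonneg (hw x) (q + 1)).1 h0.symm x
        (mem_univ x)
      exact pow_eq_zero_iff (by omega) |>.1 this
    rw [← h0, mul_zero]
    refine (sum_eq_zero fun b _ => ?_).le
    obtain ⟨y, hy⟩ := hM b
    simp only [hw0, sum_const_zero] at hy
    rw [le_antisymm hy (hM0 b), zero_pow (by omega)]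
  -- reduce to a normalized weight
  suffices key : ∀ (w : (Fin (q + 1) → ZMod (p ^ j)) → ℝ) (M : (Fin q → ZMod (p ^ j)) → ℝ),
      (∀ x, 0 ≤ w x) → (∀ b, 0 ≤ M b) → (∀ b, ∃ y : Fin (q + 1) → ZMod (p ^ j),
        M b ≤ ∑ t : ZMod (p ^ j), w (y + t • (Fin.cons 1 b : Fin (q + 1) → ZMod (p ^ j)))) →
      ∑ x, w x ^ (q + 1) = (p ^ j) ^ (q + 1) →
      ∑ b, M b ^ (q + 1) ≤
        (1 + (2 * p + 1) * (4 ^ (q + 1) * C)) * (j + 1) ^ (q + 3) * (p ^ j) ^ q *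
          (p ^ j) ^ (q + 1) by
    set S := ∑ x, w x ^ (q + 1)
    set lam : ℝ := p ^ j / S ^ ((1 : ℝ) / (q + 1 : ℕ)) with hlam
    have hroot : (S ^ ((1 : ℝ) / (q + 1 : ℕ))) ^ (q + 1) = S := by
      rw [one_div, Real.rpow_inv_natCast_pow hpos.le (by omega)]
    have hlam0 : 0 < lam := by positivity
    have hlamS : lam ^ (q + 1) * S = (p ^ j) ^ (q + 1) := by
      rw [hlam, div_pow, hroot]
      field_simp
    have := key (fun x => lam * w x) (fun b => lam * M b) (fun x => mul_nonneg hlam0.le (hw x))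
      (fun b => mul_nonneg hlam0.le (hM0 b)) (fun b => by
        obtain ⟨y, hy⟩ := hM b
        refine ⟨y, ?_⟩
        rw [← mul_sum]
        gcongr) (by
        simp only [mul_pow]
        rw [← mul_sum]
        exact hlamS)
    simp only [mul_pow] at this
    rw [← mul_sum, ← hlamS] at this
    refine le_of_mul_le_mul_left (this.trans_eq ?_) (pow_pos hlam0 (q + 1))
    ring
  clear! w M
  intro w M hw hM0 hM hsum
  have hwN : ∀ x, w x ≤ p ^ j := fun x => by
    refine le_of_pow_le_pow_left₀ (n := q + 1) (by omega) (by positivity) ?_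
    rw [← hsum]
    exact single_le_sum (f := fun x => w x ^ (q + 1)) (fun x _ => pow_nonneg (hw x) _)
      (mem_univ x)
  have hMN : ∀ b, M b ≤ p ^ (2 * j) := fun b => by
    obtain ⟨y, hy⟩ := hM b
    refine hy.trans ((sum_le_sum fun t _ => hwN _).trans_eq ?_)
    simp [ZMod.card]
    ring
  set W : (Fin (q + 1) → ZMod (p ^ j)) → ℕ := fun x => ⌈w x⌉₊
  have hWsum : ∑ x, (W x : ℝ) ^ (q + 1) ≤ 2 ^ (q + 1) * (p ^ j) ^ (q + 1) := by
    calc ∑ x, (W x : ℝ) ^ (q + 1) ≤ ∑ x, 2 ^ q * (w x ^ (q + 1) + 1 ^ (q + 1)) := by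
          refine sum_le_sum fun x _ => ?_
          refine (pow_le_pow_left₀ (by positivity) (Nat.ceil_lt_add_one (hw x)).le _).trans ?_
          exact add_pow_le (hw x) zero_le_one (q + 1)
      _ = 2 ^ (q + 1) * (p ^ j) ^ (q + 1) := by
          rw [← mul_sum, sum_add_distrib, hsum]
          simp [ZMod.card]
          ring
  set D : ℕ → Finset (Fin q → ZMod (p ^ j)) := fun i => {b | (2 : ℝ) ^ i ≤ M b}
  have hDi : ∀ i ∈ range (2 * j * p + 1), (#(D i) * (2 ^ (i + 1)) ^ (q + 1) : ℝ) ≤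
      (4 ^ (q + 1) * C) * (j + 1) ^ (q + 2) * (p ^ j) ^ q * (p ^ j) ^ (q + 1) := fun i _ => by
    rcases (D i).eq_empty_or_nonempty with he | ⟨b₀, hb₀⟩
    · rw [he]
      simp
      positivity
    have h1 := hweak j (D i) W (2 ^ i) Nat.one_le_two_pow (by
        have h2 := (mem_filter.1 hb₀).2.trans (hMN b₀)
        exact_mod_cast h2) (fun b hb => by
        obtain ⟨y, hy⟩ := hM b
        refine ⟨y, ?_⟩
        have h2 : (2 : ℝ) ^ i ≤ ∑ t : ZMod (p ^ j),
            (W (y + t • (Fin.cons 1 b : Fin (q + 1) → ZMod (p ^ j))) : ℝ) :=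
          (mem_filter.1 hb).2.trans (hy.trans (sum_le_sum fun t _ => Nat.le_ceil _))
        exact_mod_cast h2)
    push_cast at h1
    calc (#(D i) * (2 ^ (i + 1)) ^ (q + 1) : ℝ) = 2 ^ (q + 1) * (#(D i) * (2 ^ i) ^ (q + 1)) := by
          rw [pow_succ 2 i, mul_pow]
          ring
      _ ≤ 2 ^ (q + 1) * (C * (j + 1) ^ (q + 2) * (p ^ j) ^ q *
            (2 ^ (q + 1) * (p ^ j) ^ (q + 1))) := by
          refine mul_le_mul_of_nonneg_left (h1.trans ?_) (by positivity)
          gcongr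
      _ = _ := by
          rw [show (4 : ℝ) = 2 * 2 by norm_num, mul_pow 2 2]
          ring
  have hMle : ∀ b, M b ^ (q + 1) ≤
      1 + ∑ i ∈ range (2 * j * p + 1), if b ∈ D i then ((2 : ℝ) ^ (i + 1)) ^ (q + 1) else 0 :=
    fun b => by
    have hnn : ∀ i ∈ range (2 * j * p + 1),
        0 ≤ if b ∈ D i then ((2 : ℝ) ^ (i + 1)) ^ (q + 1) else 0 := fun i _ => by
      split_ifs <;> positivity
    rcases le_or_gt 1 (M b) with h1 | h1
    · obtain ⟨i, hi1, hi2⟩ := exists_nat_pow_near h1 (one_lt_two (α := ℝ))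
      have hi : i ∈ range (2 * j * p + 1) := by
        rw [mem_range, Nat.lt_succ_iff]
        have h2 : (2 : ℝ) ^ i ≤ p ^ (2 * j) := hi1.trans (hMN b)
        have h3 : 2 ^ i ≤ p ^ (2 * j) := by exact_mod_cast h2
        rw [← Nat.pow_le_pow_iff_right one_lt_two]
        refine h3.trans ((Nat.pow_le_pow_left Nat.lt_two_pow_self.le _).trans_eq ?_)
        rw [← pow_mul, mul_comm]
      have h4 := single_le_sum hnn hi
      rw [if_pos (by simpa [D] using hi1)] at h4
      have := pow_le_pow_left₀ (hM0 b) hi2.le (q + 1)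
      linarith
    · have := pow_le_one₀ (n := q + 1) (hM0 b) h1.le
      linarith [sum_nonneg hnn]
  have hj : (0 : ℝ) ≤ j := by positivity
  calc ∑ b, M b ^ (q + 1)
      ≤ ∑ b, (1 + ∑ i ∈ range (2 * j * p + 1),
          if b ∈ D i then ((2 : ℝ) ^ (i + 1)) ^ (q + 1) else 0) := sum_le_sum fun b _ => hMle b
    _ = (p ^ j) ^ q + ∑ i ∈ range (2 * j * p + 1), #(D i) * ((2 : ℝ) ^ (i + 1)) ^ (q + 1) := by
        rw [sum_add_distrib, sum_comm]
        congr 1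
        · simp [ZMod.card]
        · refine sum_congr rfl fun i _ => ?_
          rw [← sum_filter, filter_mem_eq_inter, univ_inter, sum_const, nsmul_eq_mul]
    _ ≤ (p ^ j) ^ q + ∑ i ∈ range (2 * j * p + 1),
          (4 ^ (q + 1) * C) * (j + 1) ^ (q + 2) * (p ^ j) ^ q * (p ^ j) ^ (q + 1) := by
        exact add_le_add_right (sum_le_sum hDi) _
    _ = 1 * 1 * (p ^ j) ^ q * 1 + (2 * j * p + 1) * ((4 ^ (q + 1) * C) * (j + 1) ^ (q + 2) *
          (p ^ j) ^ q * (p ^ j) ^ (q + 1)) := by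
        rw [sum_const, card_range, nsmul_eq_mul]
        push_cast
        ring
    _ ≤ 1 * (j + 1) ^ (q + 3) * (p ^ j) ^ q * (p ^ j) ^ (q + 1) + ((2 * p + 1) * (j + 1)) *
          ((4 ^ (q + 1) * C) * (j + 1) ^ (q + 2) * (p ^ j) ^ q * (p ^ j) ^ (q + 1)) := by
        gcongr
        · exact one_le_pow₀ (by linarith)
        · exact one_le_pow₀ hN
        · nlinarith
    _ = _ := by ring

end KakeyaStrong

section Oscillation

open Finset

variable {R : Type*} [CommRing R]

/-- The difference between a function and its average over translates by `π • h`. -/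
noncomputable def osc {H : Type*} [AddCommGroup H] [Module R H] [Fintype H] (π : R) (ψ : H → ℝ)
    (z : H) : ℝ :=
  ψ z - (∑ h : H, ψ (z + π • h)) / Fintype.card H

section
variable {H : Type*} [AddCommGroup H] [Module R H] [Fintype H] (π : R)

theorem sum_add_right_eq {H : Type*} [AddCommGroup H] [Fintype H] (ψ : H → ℝ) (a : H) :
    ∑ z, ψ (z + a) = ∑ z, ψ z :=
  Equiv.sum_comp (Equiv.addRight a) ψ

theorem sum_osc_smul (ψ : H → ℝ) (z : H) : ∑ h : H, osc π ψ (z + π • h) = 0 := by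
  have hc : (Fintype.card H : ℝ) ≠ 0 := by exact_mod_cast Fintype.card_ne_zero
  have h1 : ∀ h : H, ∑ h' : H, ψ (z + π • h + π • h') = ∑ h' : H, ψ (z + π • h') := fun h => by
    rw [← sum_add_right_eq (fun h' => ψ (z + π • h')) h]
    refine sum_congr rfl fun h' _ => ?_
    rw [smul_add, add_comm (π • h'), add_assoc]
  simp only [osc, sum_sub_distrib, h1, sum_const, card_univ, nsmul_eq_mul]
  field_simp
  ring

theorem sum_osc (ψ : H → ℝ) : ∑ z, osc π ψ z = 0 := by
  have hc : (Fintype.card H : ℝ) ≠ 0 := by exact_mod_cast Fintype.card_ne_zero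
  simp only [osc, sum_sub_distrib, ← sum_div]
  rw [sum_comm]
  simp only [sum_add_right_eq, sum_const, card_univ, nsmul_eq_mul]
  field_simp
  ring

theorem osc_sum {ι : Type*} (s : Finset ι) (ψ : ι → H → ℝ) (z : H) :
    osc π (fun z => ∑ i ∈ s, ψ i z) z = ∑ i ∈ s, osc π (ψ i) z := by
  simp only [osc, sum_sub_distrib, ← sum_div]
  rw [sum_comm]

theorem osc_const_mul (c : ℝ) (ψ : H → ℝ) (z : H) :
    osc π (fun z => c * ψ z) z = c * osc π ψ z := by
  simp only [osc, ← mul_sum]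
  ring

theorem abs_osc_le (ψ : H → ℝ) (B : ℝ) (h0 : ∀ z, 0 ≤ ψ z) (hB : ∀ z, ψ z ≤ B) (z : H) :
    |osc π ψ z| ≤ B := by
  have hc : (0 : ℝ) < Fintype.card H := by exact_mod_cast Fintype.card_pos
  have h1 : (∑ h : H, ψ (z + π • h)) / Fintype.card H ≤ B := by
    rw [div_le_iff₀ hc]
    refine (sum_le_sum fun h _ => hB _).trans_eq ?_
    simp [mul_comm]
  have h2 : 0 ≤ (∑ h : H, ψ (z + π • h)) / Fintype.card H :=
    div_nonneg (sum_nonneg fun h _ => h0 _) hc.le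
  rw [abs_le, osc]
  constructor <;> linarith [h0 z, hB z]

theorem sum_osc_sq_le (ψ : H → ℝ) : ∑ z, osc π ψ z ^ 2 ≤ 4 * ∑ z, ψ z ^ 2 := by
  have hc : (0 : ℝ) < Fintype.card H := by exact_mod_cast Fintype.card_pos
  have h1 : ∀ z, osc π ψ z ^ 2 ≤
      2 * ψ z ^ 2 + 2 * ((∑ h : H, ψ (z + π • h) ^ 2) / Fintype.card H) := fun z => by
    have h2 := sq_sum_le_card_mul_sum_sq (s := univ) (f := fun h : H => ψ (z + π • h))
    have h3 : ((∑ h : H, ψ (z + π • h)) / Fintype.card H) ^ 2 ≤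
        (∑ h : H, ψ (z + π • h) ^ 2) / Fintype.card H := by
      rw [div_pow, div_le_div_iff₀ (by positivity) hc]
      rw [card_univ] at h2
      nlinarith
    rw [osc]
    nlinarith [sq_nonneg (ψ z + (∑ h : H, ψ (z + π • h)) / Fintype.card H)]
  refine (sum_le_sum fun z _ => h1 z).trans_eq ?_
  rw [sum_add_distrib, ← mul_sum, ← mul_sum, ← sum_div, sum_comm]
  simp only [sum_add_right_eq (fun z => ψ z ^ 2), sum_const, card_univ, nsmul_eq_mul]
  field_simp
  ring

theorem osc_comp_linearEquiv {H' : Type*} [AddCommGroup H'] [Module R H'] [Fintype H']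
    (σ : H' ≃ₗ[R] H) (ψ : H → ℝ) (z : H') : osc π (fun z => ψ (σ z)) z = osc π ψ (σ z) := by
  simp only [osc, map_add, map_smul]
  rw [Fintype.card_congr σ.toEquiv, ← σ.toEquiv.sum_comp fun h => ψ (σ z + π • h)]
  rfl

end

variable {E : Type*} [AddCommGroup E] [Module R E]

/-- Every element is a multiple of `π` or a strict divisor of `π`, and nonzero multiples of `π` are
unit multiples, as for `p ^ (j - 1)` in `ℤ/p^j`. -/
structure IsSocle (π : R) : Prop where
  dvd_or : ∀ r, π ∣ r ∨ ∃ c, π = r * c ∧ ∀ h, IsUnit (1 + c * h)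
  mul_eq : ∀ a, π * a = 0 ∨ IsUnit a

theorem sum_line_smul_translate [Fintype E] {π r c : R} (hc : π = r * c) (hu : ∀ h, IsUnit (1 + c * h))
    (φ : R × E → ℝ) (z : R × E) (h : R × E) :
    ∑ e : E, φ (z + (r + π * h.1, (r + π * h.1) • e)) =
      ∑ e : E, φ (z + (r, r • e) + π • h) := by
  obtain ⟨u, hu⟩ := hu h.1
  refine sum_bijective (fun e => (u : R) • e - c • h.2) ?_ (by simp) fun e _ => ?_
  · refine Function.bijective_iff_has_inverse.2 ⟨fun e => (↑u⁻¹ : R) • (e + c • h.2), fun e => ?_,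
      fun e => ?_⟩
    · simp [smul_smul]
    · simp [smul_smul]
  · congr 1
    ext
    · simp [add_assoc]
    · simp only [Prod.snd_add, Prod.smul_snd, hu, smul_sub, hc, smul_smul]
      module

variable [Fintype E] [Fintype R]

theorem sum_line_eq {π : R} (hπ : IsSocle π) (φ : R × E → ℝ)
    (hφ : ∀ z, ∑ h : R × E, φ (z + π • h) = 0) (z : R × E) :
    ∑ r : R, ∑ e : E, φ (z + (r, r • e)) =
      Fintype.card E * φ z - ∑ e : E, φ (z + (0, π • e)) := by
  classical
  have hbad : ∑ r with ¬ π ∣ r, ∑ e : E, φ (z + (r, r • e)) = 0 := by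
    have h1 : ∀ h : R × E, ∑ r with ¬ π ∣ r, ∑ e : E, φ (z + (r, r • e)) =
        ∑ r with ¬ π ∣ r, ∑ e : E, φ (z + (r, r • e) + π • h) := fun h => by
      symm
      refine sum_bijective (fun r => r + π * h.1) (AddGroup.addRight_bijective _) (fun r => ?_)
        fun r hr => ?_
      · simp [dvd_add_left (dvd_mul_right π h.1)]
      · obtain ⟨c, hc, hu⟩ := (hπ.dvd_or r).resolve_left (mem_filter.1 hr).2
        exact (sum_line_smul_translate hc hu φ z h).symm
    have h2 := sum_congr rfl fun (h : R × E) (_ : h ∈ univ) => h1 h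
    have h3 : ∑ h : R × E, ∑ r with ¬ π ∣ r, ∑ e : E, φ (z + (r, r • e) + π • h) = 0 := by
      rw [sum_comm]
      refine sum_eq_zero fun r _ => ?_
      rw [sum_comm]
      exact sum_eq_zero fun e _ => hφ _
    rw [h3, sum_const] at h2
    exact (smul_eq_zero.1 h2).resolve_left (by simp)
  have hgood : ∑ r with π ∣ r, ∑ e : E, φ (z + (r, π • e)) = 0 := by
    have h1 : ∀ h : R, ∑ r with π ∣ r, ∑ e : E, φ (z + (r, π • e)) =
        ∑ r with π ∣ r, ∑ e : E, φ (z + (r, 0) + π • (h, e)) := fun h => by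
      symm
      refine sum_bijective (fun r => r + π * h) (AddGroup.addRight_bijective _) (fun r => ?_)
        fun r hr => ?_
      · simp [dvd_add_left (dvd_mul_right π h)]
      · refine sum_congr rfl fun e _ => ?_
        congr 1
        ext <;> simp [add_assoc]
    have h2 := sum_congr rfl fun (h : R) (_ : h ∈ univ) => h1 h
    have h3 : ∑ h : R, ∑ r with π ∣ r, ∑ e : E, φ (z + (r, 0) + π • (h, e)) = 0 := by
      rw [sum_comm]
      refine sum_eq_zero fun r _ => ?_
      rw [← Fintype.sum_prod_type' fun h e => φ (z + (r, 0) + π • (h, e))]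
      exact hφ _
    rw [h3, sum_const] at h2
    exact (smul_eq_zero.1 h2).resolve_left (by simp)
  have hne : ∀ r ∈ ({r | π ∣ r} : Finset R).erase 0, ∑ e : E, φ (z + (r, r • e)) =
      ∑ e : E, φ (z + (r, π • e)) := fun r hr => by
    obtain ⟨hr0, hr⟩ := mem_erase.1 hr
    obtain ⟨a, rfl⟩ := (mem_filter.1 hr).2
    obtain ⟨u, rfl⟩ := (hπ.mul_eq a).resolve_left hr0
    refine sum_bijective (fun e => (u : R) • e) ?_ (by simp) fun e _ => by simp [smul_smul]
    exact Function.bijective_iff_has_inverse.2 ⟨fun e => (↑u⁻¹ : R) • e, fun e => by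
      simp [smul_smul], fun e => by simp [smul_smul]⟩
  have h0 : (0 : R) ∈ ({r | π ∣ r} : Finset R) := by simp
  rw [← sum_filter_add_sum_filter_not univ (fun r => π ∣ r), hbad, add_zero,
    ← add_sum_erase _ _ h0, sum_congr rfl hne]
  rw [← add_sum_erase _ _ h0] at hgood
  simp only [zero_smul, sum_const, card_univ, nsmul_eq_mul]
  rw [show ((0 : R), (0 : E)) = 0 from rfl, add_zero]
  linarith

theorem sum_sq_line_le {π : R} (hπ : IsSocle π) (φ : R × E → ℝ)
    (hφ : ∀ z, ∑ h : R × E, φ (z + π • h) = 0) :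
    ∑ e : E, ∑ y : E, (∑ s : R, φ (s, y + s • e)) ^ 2 ≤
      2 * Fintype.card E * ∑ z, φ z ^ 2 := by
  have h1 : ∑ e : E, ∑ y : E, (∑ s : R, φ (s, y + s • e)) ^ 2 =
      ∑ z, φ z * ∑ r : R, ∑ e : E, φ (z + (r, r • e)) := by
    calc ∑ e : E, ∑ y : E, (∑ s : R, φ (s, y + s • e)) ^ 2
        = ∑ e : E, ∑ s : R, ∑ y : E, ∑ r : R, φ (s, y + s • e) * φ (s + r, y + (s + r) • e) := by
          refine sum_congr rfl fun e _ => ?_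
          rw [sum_comm]
          refine sum_congr rfl fun y _ => ?_
          rw [sq, sum_mul]
          refine sum_congr rfl fun s _ => ?_
          rw [mul_sum]
          exact (Equiv.sum_comp (Equiv.addLeft s) fun r => φ (s, y + s • e) * φ (r, y + r • e)).symm
      _ = ∑ e : E, ∑ s : R, ∑ y : E, ∑ r : R, φ (s, y) * φ (s + r, y + r • e) := by
          refine sum_congr rfl fun e _ => sum_congr rfl fun s _ => ?_
          rw [← Equiv.sum_comp (Equiv.addRight (s • e))
            fun y => ∑ r : R, φ (s, y) * φ (s + r, y + r • e)]
          refine sum_congr rfl fun y _ => sum_congr rfl fun r _ => ?_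
          simp [add_smul, add_assoc]
      _ = _ := by
          rw [Fintype.sum_prod_type, sum_comm]
          refine sum_congr rfl fun s _ => ?_
          rw [sum_comm]
          refine sum_congr rfl fun y _ => ?_
          rw [sum_comm, mul_sum]
          refine sum_congr rfl fun r _ => ?_
          rw [mul_sum]
          rfl
  have h2 : ∀ e : E, -(∑ z, φ z * φ (z + (0, π • e))) ≤ ∑ z, φ z ^ 2 := fun e => by
    have h3 : ∑ z, φ (z + (0, π • e)) ^ 2 = ∑ z, φ z ^ 2 :=
      Equiv.sum_comp (Equiv.addRight ((0, π • e) : R × E)) fun z => φ z ^ 2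
    have h4 : 0 ≤ ∑ z, (φ z + φ (z + (0, π • e))) ^ 2 := sum_nonneg fun z _ => sq_nonneg _
    simp only [add_sq, sum_add_distrib, h3, mul_assoc, ← mul_sum] at h4
    linarith
  rw [h1]
  simp only [sum_line_eq hπ φ hφ, mul_sub, sum_sub_distrib, mul_sum]
  rw [sum_comm (s := univ) (t := (univ : Finset E))]
  have h5 := sum_le_sum fun e (_ : e ∈ (univ : Finset E)) => h2 e
  rw [sum_neg_distrib, sum_const, nsmul_eq_mul, card_univ] at h5
  have h6 : ∑ z, φ z * (Fintype.card E * φ z) = Fintype.card E * ∑ z, φ z ^ 2 := by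
    rw [mul_sum]
    exact sum_congr rfl fun z _ => by ring
  rw [h6, ← mul_sum]
  linarith

theorem isSocle_zmod (p j : ℕ) [Fact p.Prime] : IsSocle (p ^ j : ZMod (p ^ (j + 1))) := by
  have hp : p.Prime := Fact.out
  have hnil : (p : ZMod (p ^ (j + 1))) ^ (j + 1) = 0 := by
    exact_mod_cast ZMod.natCast_self (p ^ (j + 1))
  have hunit : ∀ u : ℕ, ¬ p ∣ u → IsUnit (u : ZMod (p ^ (j + 1))) := fun u hu => by
    rw [ZMod.isUnit_iff_coprime]
    exact ((hp.coprime_iff_not_dvd.2 hu).symm).pow_right _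
  refine ⟨fun r => ?_, fun a => ?_⟩
  · rw [← ZMod.natCast_zmod_val r]
    rcases eq_or_ne r.val 0 with h0 | h0
    · left
      simp [h0]
    obtain ⟨k, u, hu, hk⟩ := Nat.exists_eq_pow_mul_and_not_dvd h0 p hp.ne_one
    rw [hk]
    push_cast
    rcases le_or_gt j k with hjk | hjk
    · exact .inl (Dvd.dvd.mul_right (pow_dvd_pow _ hjk) _)
    · right
      obtain ⟨v, hv⟩ := hunit u hu
      obtain ⟨i, rfl⟩ := Nat.exists_eq_add_of_lt hjk
      refine ⟨p ^ (i + 1) * ↑v⁻¹, ?_, fun h => ?_⟩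
      · rw [← hv]
        linear_combination (-(p : ZMod (p ^ (k + i + 1 + 1))) ^ (k + i + 1)) * v.mul_inv
      · refine IsNilpotent.isUnit_one_add ⟨k + i + 1 + 1, ?_⟩
        rw [pow_succ (p : ZMod (p ^ (k + i + 1 + 1))) i, mul_pow, mul_pow, mul_pow, hnil]
        ring
  · rw [← ZMod.natCast_zmod_val a]
    by_cases hpa : p ∣ a.val
    · left
      obtain ⟨b, hb⟩ := hpa
      rw [hb]
      push_cast
      rw [← mul_assoc, ← pow_succ, hnil, zero_mul]
    · exact .inr (hunit _ hpa)

end Oscillation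

section LevelCore

open Finset

theorem sum_pow_line_osc_le_of_normalized {R E : Type*} [CommRing R] [Fintype R] [AddCommGroup E]
    [Module R E] [Fintype E] {π : R} (hπ : IsSocle π) (q K : ℕ)
    (hE : Fintype.card E = Fintype.card R ^ (q + 2)) (hK : Fintype.card R ^ 2 ≤ 2 ^ K)
    (ψ : R × E → ℝ) (h0 : ∀ z, 0 ≤ ψ z)
    (hψ : ∑ z, ψ z ^ (q + 2) = (Fintype.card R : ℝ) ^ (q + 3)) :
    ∑ e : E, ∑ y : E, |∑ s : R, osc π ψ (s, y + s • e)| ^ (q + 2) ≤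
      2 ^ (q + 4) * (K + 2) ^ (q + 2) * Fintype.card R ^ (2 * q + 2) * ∑ z, ψ z ^ (q + 2) := by
  classical
  set N : ℝ := (Fintype.card R : ℝ) with hN
  have hN1 : 1 ≤ N := by
    rw [hN]
    exact_mod_cast Fintype.card_pos
  have hψle : ∀ z, ψ z ≤ 2 ^ K := fun z => by
    have h1 : ψ z ^ (q + 2) ≤ (N ^ 2) ^ (q + 2) := by
      calc ψ z ^ (q + 2) ≤ ∑ z, ψ z ^ (q + 2) :=
            single_le_sum (f := fun z => ψ z ^ (q + 2)) (fun z _ => pow_nonneg (h0 z) _)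
              (mem_univ z)
        _ = N ^ (q + 3) := hψ
        _ ≤ N ^ (2 * (q + 2)) := pow_le_pow_right₀ hN1 (by omega)
        _ = _ := pow_mul _ _ _
    refine (le_of_pow_le_pow_left₀ (by omega) (by positivity) h1).trans ?_
    rw [hN]
    exact_mod_cast hK
  have hlev : ∀ z, ∃ i < K + 2, ψ z ≤ 2 ^ i ∧ (i = 0 ∨ (2 : ℝ) ^ i ≤ 2 * ψ z) := fun z => by
    rcases le_or_gt 1 (ψ z) with h1 | h1
    · obtain ⟨i, hi1, hi2⟩ := exists_nat_pow_near h1 (one_lt_two (α := ℝ))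
      refine ⟨i + 1, ?_, hi2.le, .inr ?_⟩
      · have := (pow_le_pow_iff_right₀ (one_lt_two (α := ℝ))).1 (hi1.trans (hψle z))
        omega
      · rw [pow_succ]
        linarith
    · exact ⟨0, by omega, by simpa using h1.le, .inl rfl⟩
  choose l hl1 hl2 hl3 using hlev
  set ψ' : ℕ → R × E → ℝ := fun i z => if l z = i then ψ z else 0 with hψ'
  have hsum : ψ = fun z => ∑ i ∈ range (K + 2), ψ' i z := by
    ext z
    simp [hψ', hl1]
  have hψ'0 : ∀ i z, 0 ≤ ψ' i z := fun i z => by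
    simp only [hψ']
    split_ifs
    exacts [h0 z, le_rfl]
  have hψ'1 : ∀ i z, ψ' i z ≤ 2 ^ i := fun i z => by
    simp only [hψ']
    split_ifs with h
    exacts [h ▸ hl2 z, by positivity]
  have hψ'2 : ∀ i, (2 ^ i) ^ q * ∑ z, ψ' i z ^ 2 ≤ 2 ^ (q + 1) * ∑ z, ψ z ^ (q + 2) := fun i => by
    have h1 : ∀ z, (2 ^ i) ^ q * ψ' i z ^ 2 ≤ 2 ^ q * (ψ z ^ (q + 2) + 1) := fun z => by
      have h4 : 0 ≤ ψ z ^ (q + 2) := pow_nonneg (h0 z) _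
      have h2 : (1 : ℝ) ≤ 2 ^ q := one_le_pow₀ one_le_two
      simp only [hψ']
      split_ifs with h
      · subst h
        rcases hl3 z with h3 | h3
        · have h5 := hl2 z
          rw [h3, pow_zero] at h5 ⊢
          have := pow_le_one₀ (n := 2) (h0 z) h5
          rw [one_pow, one_mul]
          nlinarith
        · calc ((2 : ℝ) ^ l z) ^ q * ψ z ^ 2 ≤ (2 * ψ z) ^ q * ψ z ^ 2 := by gcongr
            _ = 2 ^ q * (ψ z ^ (q + 2) + 0) := by rw [mul_pow]; ring
            _ ≤ _ := by gcongr; exact zero_le_one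
      · have : 0 ≤ 2 ^ q * (ψ z ^ (q + 2) + 1) := by positivity
        simpa using this
    rw [mul_sum]
    refine (sum_le_sum fun z _ => h1 z).trans_eq ?_
    rw [← mul_sum, sum_add_distrib, hψ]
    simp only [sum_const, card_univ, Fintype.card_prod, hE, nsmul_eq_mul]
    push_cast
    ring
  have hpiece : ∀ i, ∑ e : E, ∑ y : E, |∑ s : R, osc π (ψ' i) (s, y + s • e)| ^ (q + 2) ≤
      2 ^ (q + 4) * N ^ (2 * q + 2) * ∑ z, ψ z ^ (q + 2) := fun i => by
    have h1 : ∀ e y : E, |∑ s : R, osc π (ψ' i) (s, y + s • e)| ≤ N * 2 ^ i := fun e y => by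
      refine (abs_sum_le_sum_abs _ _).trans ((sum_le_sum fun s _ =>
        abs_osc_le π (ψ' i) _ (hψ'0 i) (hψ'1 i) _).trans_eq ?_)
      simp [hN]
    calc ∑ e : E, ∑ y : E, |∑ s : R, osc π (ψ' i) (s, y + s • e)| ^ (q + 2)
        ≤ ∑ e : E, ∑ y : E, (N * 2 ^ i) ^ q * (∑ s : R, osc π (ψ' i) (s, y + s • e)) ^ 2 := by
          refine sum_le_sum fun e _ => sum_le_sum fun y _ => ?_
          rw [pow_add, sq_abs]
          gcongr
          exact h1 e y
      _ = (N * 2 ^ i) ^ q *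
            ∑ e : E, ∑ y : E, (∑ s : R, osc π (ψ' i) (s, y + s • e)) ^ 2 := by
          simp only [mul_sum]
      _ ≤ (N * 2 ^ i) ^ q * (2 * N ^ (q + 2) * (4 * ∑ z, ψ' i z ^ 2)) := by
          gcongr
          refine (sum_sq_line_le hπ (osc π (ψ' i)) (sum_osc_smul π _)).trans ?_
          rw [hE]
          push_cast
          gcongr
          exact sum_osc_sq_le π _
      _ = 8 * N ^ (2 * q + 2) * ((2 ^ i) ^ q * ∑ z, ψ' i z ^ 2) := by
          rw [mul_pow]
          ring
      _ ≤ 8 * N ^ (2 * q + 2) * (2 ^ (q + 1) * ∑ z, ψ z ^ (q + 2)) := by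
          exact mul_le_mul_of_nonneg_left (hψ'2 i) (by positivity)
      _ = _ := by ring
  have hT : ∀ e y : E, |∑ s : R, osc π ψ (s, y + s • e)| ^ (q + 2) ≤
      (K + 2) ^ (q + 1) * ∑ i ∈ range (K + 2), |∑ s : R, osc π (ψ' i) (s, y + s • e)| ^ (q + 2) :=
    fun e y => by
    have h1 : ∑ s : R, osc π ψ (s, y + s • e) =
        ∑ i ∈ range (K + 2), ∑ s : R, osc π (ψ' i) (s, y + s • e) := by
      rw [sum_comm]
      refine sum_congr rfl fun s _ => ?_
      rw [← osc_sum, ← hsum]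
    have h3 := pow_sum_div_card_le_sum_pow (s := range (K + 2))
      (f := fun i => |∑ s : R, osc π (ψ' i) (s, y + s • e)|) (fun i _ => abs_nonneg _) (q + 1)
    rw [card_range, div_le_iff₀ (by positivity)] at h3
    rw [h1]
    refine (pow_le_pow_left₀ (abs_nonneg _) (abs_sum_le_sum_abs _ _) _).trans (h3.trans_eq ?_)
    push_cast
    ring
  calc ∑ e : E, ∑ y : E, |∑ s : R, osc π ψ (s, y + s • e)| ^ (q + 2)
      ≤ ∑ e : E, ∑ y : E, (K + 2) ^ (q + 1) *
          ∑ i ∈ range (K + 2), |∑ s : R, osc π (ψ' i) (s, y + s • e)| ^ (q + 2) :=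
        sum_le_sum fun e _ => sum_le_sum fun y _ => hT e y
    _ = (K + 2) ^ (q + 1) * ∑ i ∈ range (K + 2),
          ∑ e : E, ∑ y : E, |∑ s : R, osc π (ψ' i) (s, y + s • e)| ^ (q + 2) := by
        simp only [← mul_sum]
        congr 1
        rw [sum_comm]
        simp only [sum_comm (s := univ) (t := range (K + 2))]
        refine sum_congr rfl fun i _ => ?_
        rw [sum_comm]
    _ ≤ (K + 2) ^ (q + 1) * ∑ i ∈ range (K + 2),
          (2 ^ (q + 4) * N ^ (2 * q + 2) * ∑ z, ψ z ^ (q + 2)) := by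
        gcongr with i
        exact hpiece i
    _ = _ := by
        rw [sum_const, card_range, nsmul_eq_mul]
        push_cast
        ring

theorem sum_pow_line_osc_le {R E : Type*} [CommRing R] [Fintype R] [AddCommGroup E]
    [Module R E] [Fintype E] {π : R} (hπ : IsSocle π) (q K : ℕ)
    (hE : Fintype.card E = Fintype.card R ^ (q + 2)) (hK : Fintype.card R ^ 2 ≤ 2 ^ K)
    (ψ : R × E → ℝ) (h0 : ∀ z, 0 ≤ ψ z) :
    ∑ e : E, ∑ y : E, |∑ s : R, osc π ψ (s, y + s • e)| ^ (q + 2) ≤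
      2 ^ (q + 4) * (K + 2) ^ (q + 2) * Fintype.card R ^ (2 * q + 2) * ∑ z, ψ z ^ (q + 2) := by
  have hN : (0 : ℝ) < Fintype.card R := by exact_mod_cast Fintype.card_pos
  rcases (sum_nonneg fun z _ => pow_nonneg (h0 z) (q + 2) : 0 ≤ ∑ z, ψ z ^ (q + 2)).eq_or_lt
    with hz | hpos
  · have hψ0 : ∀ z, ψ z = 0 := fun z => by
      have := (sum_eq_zero_iff_of_nonneg fun z _ => pow_nonneg (h0 z) (q + 2)).1 hz.symm z
        (mem_univ z)
      exact pow_eq_zero_iff (by omega) |>.1 this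
    simp [osc, hψ0]
  · set S := ∑ z, ψ z ^ (q + 2)
    obtain ⟨lam, hlam0, hlam⟩ : ∃ lam : ℝ, 0 < lam ∧
        lam ^ (q + 2) * S = (Fintype.card R : ℝ) ^ (q + 3) := by
      refine ⟨((Fintype.card R : ℝ) ^ (q + 3) / S) ^ ((q + 2 : ℕ) : ℝ)⁻¹, by positivity, ?_⟩
      rw [Real.rpow_inv_natCast_pow (by positivity) (by omega)]
      field_simp
    have := sum_pow_line_osc_le_of_normalized hπ q K hE hK (fun z => lam * ψ z)
      (fun z => mul_nonneg hlam0.le (h0 z)) (by simp only [mul_pow, ← mul_sum]; exact hlam)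
    simp only [osc_const_mul, ← mul_sum, abs_mul, mul_pow, abs_of_pos hlam0] at this
    refine le_of_mul_le_mul_left (this.trans_eq ?_) (pow_pos hlam0 (q + 2))
    ring

theorem sum_plane_osc_le (p q : ℕ) [Fact p.Prime] : ∃ C : ℝ, 0 < C ∧ ∀ (j : ℕ)
    (ψ : ZMod (p ^ (j + 1)) × (Fin (q + 1) → ZMod (p ^ (j + 1))) → ℝ)
    (M : (Fin (q + 1) → ZMod (p ^ (j + 1))) → (Fin q → ZMod (p ^ (j + 1))) → ℝ),
    (∀ z, 0 ≤ ψ z) → (∀ e b, 0 ≤ M e b) →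
    (∀ e b, ∃ y : Fin (q + 1) → ZMod (p ^ (j + 1)),
      M e b ≤ |∑ t : ZMod (p ^ (j + 1)), ∑ s : ZMod (p ^ (j + 1)),
        osc (p ^ j : ZMod (p ^ (j + 1))) ψ (s, y +
          t • (Fin.cons 1 b : Fin (q + 1) → ZMod (p ^ (j + 1))) + s • e)|) →
    ∑ e, ∑ b, M e b ^ (q + 1) ≤
      C * (j + 2) ^ (2 * q + 4) * (p ^ (j + 1)) ^ (3 * q) * ∑ z, ψ z ^ (q + 1) := by
  have hp : p.Prime := Fact.out
  have hp0 : (0 : ℝ) < p := by exact_mod_cast hp.pos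
  obtain ⟨C, hC, hkak⟩ := kakeya_strong p q
  refine ⟨C * 2 ^ (q + 3) * (2 * p + 2) ^ (q + 1), by positivity, fun j ψ M hψ hM0 hM => ?_⟩
  rcases q with _ | q
  · have hzero : ∀ e b, M e b = 0 := fun e b => by
      obtain ⟨y, hy⟩ := hM e b
      refine le_antisymm (hy.trans_eq ?_) (hM0 e b)
      rw [abs_eq_zero, ← sum_osc (p ^ j : ZMod (p ^ (j + 1))) ψ, Fintype.sum_prod_type, sum_comm]
      refine sum_congr rfl fun s _ => ?_
      refine sum_bijective (fun t => y + t • (Fin.cons 1 b : Fin (0 + 1) → ZMod (p ^ (j + 1))) +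
        s • e) ?_ (by simp) fun t _ => rfl
      refine Function.bijective_iff_has_inverse.2 ⟨fun z => (z - s • e - y) 0, fun t => ?_,
        fun z => ?_⟩
      · simp
      · ext i
        obtain rfl : i = 0 := Fin.ext (by omega)
        simp
    simp only [hzero, zero_add, pow_one, sum_const_zero]
    have := sum_nonneg fun z (_ : z ∈ univ) => hψ z
    positivity
  · set K : ℕ := 2 * (j + 1) * p with hK
    have hbound := fun e => hkak (j + 1)
      (fun y => |∑ s : ZMod (p ^ (j + 1)), osc (p ^ j : ZMod (p ^ (j + 1))) ψ (s, y + s • e)|)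
      (M e) (fun y => abs_nonneg _) (hM0 e) fun b => by
        obtain ⟨y, hy⟩ := hM e b
        exact ⟨y, hy.trans (abs_sum_le_sum_abs _ _)⟩
    have hline := sum_pow_line_osc_le (isSocle_zmod p j) q K (E := Fin (q + 2) → ZMod (p ^ (j + 1)))
      (by simp [ZMod.card]) (by
        rw [ZMod.card, ← pow_mul]
        refine (Nat.pow_le_pow_left Nat.lt_two_pow_self.le _).trans_eq ?_
        rw [← pow_mul, hK]
        congr 1
        ring) ψ hψ
    rw [ZMod.card] at hline
    push_cast at hline hbound
    have hS : 0 ≤ ∑ z, ψ z ^ (q + 2) := sum_nonneg fun z _ => pow_nonneg (hψ z) _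
    have hK2 : (K : ℝ) + 2 ≤ (2 * p + 2) * (j + 2) := by
      rw [hK]
      push_cast
      have : (0 : ℝ) ≤ j := by positivity
      nlinarith
    calc ∑ e, ∑ b, M e b ^ (q + 1 + 1)
        ≤ ∑ e, C * (j + 1 + 1) ^ (q + 1 + 3) * (p ^ (j + 1)) ^ (q + 1) *
          ∑ y, |∑ s : ZMod (p ^ (j + 1)),
            osc (p ^ j : ZMod (p ^ (j + 1))) ψ (s, y + s • e)| ^ (q + 1 + 1) :=
          sum_le_sum fun e _ => hbound e
      _ ≤ C * (j + 1 + 1) ^ (q + 1 + 3) * (p ^ (j + 1)) ^ (q + 1) * (2 ^ (q + 4) *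
            (K + 2) ^ (q + 2) * (p ^ (j + 1)) ^ (2 * q + 2) * ∑ z, ψ z ^ (q + 2)) := by
          rw [← mul_sum]
          gcongr
      _ ≤ C * (j + 1 + 1) ^ (q + 1 + 3) * (p ^ (j + 1)) ^ (q + 1) * (2 ^ (q + 4) *
            ((2 * p + 2) * (j + 2)) ^ (q + 2) * (p ^ (j + 1)) ^ (2 * q + 2) *
            ∑ z, ψ z ^ (q + 2)) := by
          gcongr
      _ = _ := by
          rw [mul_pow (2 * (p : ℝ) + 2)]
          ring

end LevelCore

section PlaneSums

open Finset

variable {R : Type*} [CommRing R]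

/-- The `R`-module `R × R^{q+1}` is `R^{q+2}`, with two prescribed coordinates put first. -/
theorem exists_linearEquiv_coords (q : ℕ) {i k : Fin (q + 2)} (hik : i ≠ k) :
    ∃ σ : (R × (Fin (q + 1) → R)) ≃ₗ[R] (Fin (q + 2) → R), ∀ x,
      (σ.symm x).1 = x i ∧ (σ.symm x).2 0 = x k := by
  obtain ⟨τ, hτ0, hτ1⟩ : ∃ τ : Equiv.Perm (Fin (q + 2)), τ 0 = i ∧ τ 1 = k := by
    refine ⟨Equiv.swap (Equiv.swap 0 i 1) k * Equiv.swap 0 i, ?_, ?_⟩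
    · simp only [Equiv.Perm.mul_apply, Equiv.swap_apply_left]
      refine Equiv.swap_apply_of_ne_of_ne (fun h => ?_) hik
      have := (Equiv.swap 0 i).injective ((Equiv.swap_apply_left 0 i).trans h)
      exact absurd this (by simp)
    · simp
  refine ⟨(Fin.consLinearEquiv R (fun _ : Fin (q + 2) => R)).trans
    (LinearEquiv.funCongrLeft R R τ.symm), fun x => ?_⟩
  simp [← hτ0, ← hτ1, LinearEquiv.funCongrLeft, LinearMap.funLeft]
  rfl

variable [Fintype R]

theorem sum_plane_change {H : Type*} [AddCommGroup H] [Module R H] (f : H → ℝ) (a u v : H)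
    {α γ : R} (β : R) (hα : IsUnit α) (hγ : IsUnit γ) :
    ∑ s : R, ∑ t : R, f (a + s • (α • u) + t • (β • u + γ • v)) =
      ∑ t : R, ∑ s : R, f (a + s • u + t • v) := by
  rw [sum_comm]
  refine sum_bijective (fun t => t * γ) (IsUnit.isUnit_iff_mulRight_bijective.1 hγ) (by simp)
    fun t _ => ?_
  refine sum_bijective (fun s => s * α + t * β) ?_ (by simp) fun s _ => ?_
  · exact (AddGroup.addRight_bijective (t * β)).comp (IsUnit.isUnit_iff_mulRight_bijective.1 hα)
  · congr 1
    module

theorem sum_normalized_pairs_le (q : ℕ)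
    (S : Finset ((R × (Fin (q + 1) → R)) × (R × (Fin (q + 1) → R))))
    (hS : ∀ x ∈ S, IsUnit x.1.1 ∧ IsUnit (x.1.1 * x.2.2 0 - x.1.2 0 * x.2.1))
    (B : (R × (Fin (q + 1) → R)) → (R × (Fin (q + 1) → R)) → ℝ)
    (M : (Fin (q + 1) → R) → (Fin q → R) → ℝ) (hM : ∀ e b, 0 ≤ M e b)
    (hB : ∀ (α β γ : R) (e : Fin (q + 1) → R) (b : Fin q → R), IsUnit α → IsUnit γ →
      B (α • (1, e)) (β • (1, e) + γ • (0, Fin.cons 1 b)) ≤ M e b) :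
    ∑ x ∈ S, B x.1 x.2 ≤ (Fintype.card R : ℝ) ^ 3 * ∑ e, ∑ b, M e b := by
  classical
  let γ : (R × (Fin (q + 1) → R)) × (R × (Fin (q + 1) → R)) → Fin (q + 1) → R := fun x =>
    x.2.2 - x.2.1 • (Ring.inverse x.1.1 • x.1.2)
  let F : (R × (Fin (q + 1) → R)) × (R × (Fin (q + 1) → R)) →
      (R × R × R) × ((Fin (q + 1) → R) × (Fin q → R)) := fun x =>
    ((x.1.1, x.2.1, γ x 0), (Ring.inverse x.1.1 • x.1.2, fun i => Ring.inverse (γ x 0) * γ x i.succ))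
  let G : (R × R × R) × ((Fin (q + 1) → R) × (Fin q → R)) →
      (R × (Fin (q + 1) → R)) × (R × (Fin (q + 1) → R)) := fun y =>
    (y.1.1 • (1, y.2.1), y.1.2.1 • (1, y.2.1) + y.1.2.2 • (0, Fin.cons 1 y.2.2))
  have hγ : ∀ x ∈ S, IsUnit (γ x 0) := fun x hx => by
    obtain ⟨h1, h2⟩ := hS x hx
    have h3 : x.1.1 * γ x 0 = x.1.1 * x.2.2 0 - x.1.2 0 * x.2.1 := by
      simp only [γ, Pi.sub_apply, Pi.smul_apply, smul_eq_mul]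
      linear_combination (-x.2.1 * x.1.2 0) * Ring.mul_inverse_cancel _ h1
    rw [← h3] at h2
    exact isUnit_of_mul_isUnit_right h2
  have hGF : ∀ x ∈ S, G (F x) = x := fun x hx => by
    obtain ⟨h1, -⟩ := hS x hx
    have h2 := hγ x hx
    ext i
    · simp [G, F]
    · simp only [G, F, Prod.smul_mk, smul_smul, Ring.mul_inverse_cancel _ h1, one_smul]
    · simp [G, F]
    · refine Fin.cases ?_ (fun i => ?_) i
      · simp [G, F, γ]
      · have h3 := Ring.mul_inverse_cancel _ h2
        simp only [G, F, Prod.smul_mk, Prod.mk_add_mk, Pi.add_apply, Pi.smul_apply, Fin.cons_succ,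
          smul_eq_mul, ← mul_assoc, h3, one_mul]
        simp [γ, mul_assoc]
  calc ∑ x ∈ S, B x.1 x.2 ≤ ∑ x ∈ S, M (F x).2.1 (F x).2.2 := by
        refine sum_le_sum fun x hx => ?_
        conv_lhs => rw [← hGF x hx]
        exact hB _ _ _ _ _ (hS x hx).1 (hγ x hx)
    _ = ∑ y ∈ S.image F, M y.2.1 y.2.2 := by
        rw [sum_image]
        intro x hx y hy hxy
        rw [← hGF x hx, ← hGF y hy, hxy]
    _ ≤ ∑ y : (R × R × R) × ((Fin (q + 1) → R) × (Fin q → R)), M y.2.1 y.2.2 :=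
        sum_le_sum_of_subset_of_nonneg (subset_univ _) fun y _ _ => hM _ _
    _ = _ := by
        simp only [Fintype.sum_prod_type, sum_const, card_univ, nsmul_eq_mul, Fintype.card_prod]
        push_cast
        ring

theorem isUnit_or_isUnit_of_isUnit_sub_zmod {p j : ℕ} [Fact p.Prime] {a b : ZMod (p ^ (j + 1))}
    (h : IsUnit (a - b)) : IsUnit a ∨ IsUnit b := by
  have hp : p.Prime := Fact.out
  by_contra! hab
  have ha := ((isSocle_zmod p j).mul_eq a).resolve_right hab.1
  have hb := ((isSocle_zmod p j).mul_eq b).resolve_right hab.2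
  have h1 : (p ^ j : ZMod (p ^ (j + 1))) * (a - b) = 0 := by rw [mul_sub, ha, hb, sub_zero]
  rw [h.mul_left_eq_zero] at h1
  have h2 : ((p ^ j : ℕ) : ZMod (p ^ (j + 1))) = 0 := by exact_mod_cast h1
  rw [ZMod.natCast_eq_zero_iff, Nat.pow_dvd_pow_iff_le_right hp.one_lt] at h2
  omega

theorem sum_matrix_osc_le (p q : ℕ) [Fact p.Prime] : ∃ C : ℝ, 0 < C ∧ ∀ (j : ℕ)
    (φ : (Fin (q + 2) → ZMod (p ^ (j + 1))) → ℝ)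
    (A : (Fin 2 → Fin (q + 2) → ZMod (p ^ (j + 1))) → ℝ)
    (S : Finset (Fin 2 → Fin (q + 2) → ZMod (p ^ (j + 1)))),
    (∀ z, 0 ≤ φ z) → (∀ g, 0 ≤ A g) →
    (∀ g, ∃ a, A g ≤ |∑ s : ZMod (p ^ (j + 1)), ∑ t : ZMod (p ^ (j + 1)),
        osc (p ^ j : ZMod (p ^ (j + 1))) φ (a + s • g 0 + t • g 1)|) →
    (∀ g ∈ S, ∃ i k, IsUnit (g 0 i * g 1 k - g 0 k * g 1 i)) →
    ∑ g ∈ S, A g ^ (q + 1) ≤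
      C * (j + 2) ^ (2 * q + 4) * (p ^ (j + 1)) ^ (3 * q + 3) * ∑ z, φ z ^ (q + 1) := by
  classical
  obtain ⟨C, hC, hplane⟩ := sum_plane_osc_le p q
  refine ⟨(q + 2) ^ 2 * C, by positivity, fun j φ A S hφ hA0 hA hS => ?_⟩
  have : Fact (1 < p ^ (j + 1)) := ⟨Nat.one_lt_pow (by omega) (Fact.out : p.Prime).one_lt⟩
  let T : Fin (q + 2) × Fin (q + 2) → Finset (Fin 2 → Fin (q + 2) → ZMod (p ^ (j + 1))) := fun ik =>
    {g | IsUnit (g 0 ik.1) ∧ IsUnit (g 0 ik.1 * g 1 ik.2 - g 0 ik.2 * g 1 ik.1)}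
  have hST : ∀ g ∈ S, ∃ ik, g ∈ T ik := fun g hg => by
    obtain ⟨i, k, hik⟩ := hS g hg
    rcases isUnit_or_isUnit_of_isUnit_sub_zmod hik with h | h
    · exact ⟨(i, k), by simpa [T] using ⟨isUnit_of_mul_isUnit_left h, hik⟩⟩
    · refine ⟨(k, i), ?_⟩
      rw [← neg_sub, IsUnit.neg_iff] at hik
      simpa [T] using ⟨isUnit_of_mul_isUnit_left h, hik⟩
  have hT : ∀ ik, ∑ g ∈ T ik, A g ^ (q + 1) ≤
      C * (j + 2) ^ (2 * q + 4) * (p ^ (j + 1)) ^ (3 * q + 3) * ∑ z, φ z ^ (q + 1) := by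
    rintro ⟨i, k⟩
    have hrhs : 0 ≤ ∑ z, φ z ^ (q + 1) := sum_nonneg fun z _ => pow_nonneg (hφ z) _
    rcases eq_or_ne i k with rfl | hik
    · have : T (i, i) = ∅ := by
        ext g
        simp [T]
      rw [this, sum_empty]
      positivity
    obtain ⟨σ, hσ⟩ := exists_linearEquiv_coords (R := ZMod (p ^ (j + 1))) q hik
    let ψ : ZMod (p ^ (j + 1)) × (Fin (q + 1) → ZMod (p ^ (j + 1))) → ℝ := fun z => φ (σ z)
    let P : (Fin (q + 1) → ZMod (p ^ (j + 1))) → (Fin q → ZMod (p ^ (j + 1))) → ZMod (p ^ (j + 1)) × (Fin (q + 1) → ZMod (p ^ (j + 1))) → ℝ := fun e b a =>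
      |∑ t : ZMod (p ^ (j + 1)), ∑ s : ZMod (p ^ (j + 1)), osc (p ^ j : ZMod (p ^ (j + 1))) ψ (a + s • (1, e) + t • (0, Fin.cons 1 b))|
    choose a₀ ha₀ using fun e b => Finite.exists_max (P e b)
    have h1 := hplane j ψ (fun e b => P e b (a₀ e b)) (fun z => hφ _) (fun e b => abs_nonneg _)
      fun e b => by
        refine ⟨(a₀ e b).2 - (a₀ e b).1 • e, le_of_eq ?_⟩
        simp only [P]
        congr 1
        refine sum_congr rfl fun t _ => ?_
        conv_rhs => rw [← Equiv.sum_comp (Equiv.addLeft (a₀ e b).1)]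
        refine sum_congr rfl fun s _ => ?_
        congr 1
        refine Prod.ext (by simp) ?_
        simp only [Equiv.coe_addLeft, Prod.snd_add, Prod.smul_snd]
        module
    let S' : Finset ((ZMod (p ^ (j + 1)) × (Fin (q + 1) → ZMod (p ^ (j + 1)))) ×
        (ZMod (p ^ (j + 1)) × (Fin (q + 1) → ZMod (p ^ (j + 1))))) :=
      {x | IsUnit x.1.1 ∧ IsUnit (x.1.1 * x.2.2 0 - x.1.2 0 * x.2.1)}
    have h2 := sum_normalized_pairs_le q S' (fun x hx => (mem_filter.1 hx).2)
      (fun u v => A ![σ u, σ v] ^ (q + 1)) (fun e b => P e b (a₀ e b) ^ (q + 1))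
      (fun e b => pow_nonneg (abs_nonneg _) _) fun α β γ e b hα hγ => by
        refine pow_le_pow_left₀ (hA0 _) ?_ _
        obtain ⟨a, ha⟩ := hA ![σ (α • (1, e)), σ (β • (1, e) + γ • (0, Fin.cons 1 b))]
        refine ha.trans (le_trans (le_of_eq ?_) (ha₀ e b (σ.symm a)))
        simp only [P]
        rw [← sum_plane_change (osc (p ^ j : ZMod (p ^ (j + 1))) ψ) (σ.symm a) (1, e) (0, Fin.cons 1 b) β hα hγ]
        congr 1
        refine sum_congr rfl fun s _ => sum_congr rfl fun t _ => ?_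
        rw [osc_comp_linearEquiv]
        simp only [map_add, map_smul, LinearEquiv.apply_symm_apply, Matrix.cons_val_zero,
          Matrix.cons_val_one]
    calc ∑ g ∈ T (i, k), A g ^ (q + 1) = ∑ x ∈ S', A ![σ x.1, σ x.2] ^ (q + 1) := by
          refine sum_bij' (fun g _ => (σ.symm (g 0), σ.symm (g 1))) (fun x _ => ![σ x.1, σ x.2])
            (fun g hg => ?_) (fun x hx => ?_) (fun g _ => ?_) (fun x _ => ?_) fun g _ => ?_
          · simpa [S', hσ] using (mem_filter.1 hg).2
          · have := (mem_filter.1 hx).2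
            simpa [T, ← hσ] using this
          · ext l : 1
            fin_cases l <;> simp
          · simp
          · congr 2
            ext l : 1
            fin_cases l <;> simp
      _ ≤ _ := h2
      _ ≤ (p ^ (j + 1)) ^ 3 * (C * (j + 2) ^ (2 * q + 4) * (p ^ (j + 1)) ^ (3 * q) *
            ∑ z, ψ z ^ (q + 1)) := by
          rw [ZMod.card]
          push_cast
          exact mul_le_mul_of_nonneg_left h1 (by positivity)
      _ = _ := by
          rw [← Equiv.sum_comp σ.toEquiv fun z => φ z ^ (q + 1)]
          simp only [ψ, LinearEquiv.coe_toEquiv]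
          ring
  calc ∑ g ∈ S, A g ^ (q + 1) ≤ ∑ g, ∑ ik, if g ∈ T ik then A g ^ (q + 1) else 0 := by
        refine (sum_le_sum fun g hg => ?_).trans (sum_le_sum_of_subset_of_nonneg (subset_univ S)
          fun g _ _ => sum_nonneg fun ik _ => ?_)
        · obtain ⟨ik, h⟩ := hST g hg
          refine le_trans (by rw [if_pos h]) (single_le_sum
            (f := fun ik => if g ∈ T ik then A g ^ (q + 1) else 0) (fun ik _ => ?_) (mem_univ ik))
          split_ifs
          exacts [pow_nonneg (hA0 g) _, le_rfl]
        · split_ifs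
          exacts [pow_nonneg (hA0 g) _, le_rfl]
    _ = ∑ ik, ∑ g ∈ T ik, A g ^ (q + 1) := by
        rw [sum_comm]
        refine sum_congr rfl fun ik _ => ?_
        rw [← sum_filter, filter_mem_eq_inter, univ_inter]
    _ ≤ ∑ ik : Fin (q + 2) × Fin (q + 2),
          C * (j + 2) ^ (2 * q + 4) * (p ^ (j + 1)) ^ (3 * q + 3) * ∑ z, φ z ^ (q + 1) :=
        sum_le_sum fun ik _ => hT ik
    _ = _ := by
        simp only [sum_const, card_univ, Fintype.card_prod, Fintype.card_fin, nsmul_eq_mul]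
        push_cast
        ring

end PlaneSums

section Telescoping

open Finset
open scoped BigOperators

theorem expect_comp_of_surjective {A B : Type*} [AddCommGroup A] [AddCommGroup B] [Fintype A]
    [Fintype B] (c : A →+ B) (hc : Function.Surjective c) (F : B → ℝ) :
    𝔼 a, F (c a) = 𝔼 b, F b := by
  classical
  have hfib : ∀ b, #{a | c a = b} = #{a | c a = 0} := fun b =>
    AddMonoidHom.card_fiber_eq_of_mem_range c (hc b) (hc 0)
  have hsum : ∀ G : B → ℝ, ∑ a, G (c a) = #{a | c a = 0} * ∑ b, G b := fun G => by
    rw [← sum_fiberwise univ c, mul_sum]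
    refine sum_congr rfl fun b _ => ?_
    rw [← hfib b, ← nsmul_eq_mul, ← sum_const]
    exact sum_congr rfl fun a ha => by rw [(mem_filter.1 ha).2]
  have hcard : (Fintype.card A : ℝ) = #{a | c a = 0} * Fintype.card B := by
    have := hsum fun _ => 1
    simpa using this
  have h0 : (#{a | c a = 0} : ℝ) ≠ 0 := by
    rw [Nat.cast_ne_zero, card_ne_zero]
    exact ⟨0, by simp⟩
  rw [Fintype.expect_eq_sum_div_card, Fintype.expect_eq_sum_div_card, hsum, hcard,
    mul_div_mul_left _ _ h0]

theorem expect_pow_le {α : Type*} [Fintype α] [Nonempty α] (m : ℕ) (f : α → ℝ)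
    (hf : ∀ x, 0 ≤ f x) : (𝔼 x, f x) ^ (m + 1) ≤ 𝔼 x, f x ^ (m + 1) := by
  have h := pow_sum_div_card_le_sum_pow (s := univ) (fun x _ => hf x) m
  have h0 : (0 : ℝ) < Fintype.card α := by exact_mod_cast Fintype.card_pos
  rw [card_univ, div_le_iff₀ (by positivity)] at h
  rw [Fintype.expect_eq_sum_div_card, Fintype.expect_eq_sum_div_card, div_pow,
    div_le_div_iff₀ (by positivity) h0, pow_succ (Fintype.card α : ℝ), ← mul_assoc]
  exact mul_le_mul_of_nonneg_right h h0.le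

theorem expect_add_pow_le {α : Type*} [Fintype α] {m : ℕ} {f g : α → ℝ} {a b T : ℝ}
    (ha : 0 < a) (hb : 0 < b) (hf : ∀ x, 0 ≤ f x) (hg : ∀ x, 0 ≤ g x)
    (h1 : 𝔼 x, f x ^ m ≤ a ^ m * T) (h2 : 𝔼 x, g x ^ m ≤ b ^ m * T) :
    𝔼 x, (f x + g x) ^ m ≤ (a + b) ^ m * T := by
  have key : ∀ x, (f x + g x) ^ m ≤
      (a + b) ^ m * (a / (a + b) * (1 / a ^ m * f x ^ m) + b / (a + b) * (1 / b ^ m * g x ^ m)) :=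
    fun x => by
    have h := (convexOn_pow (𝕜 := ℝ) m).2
      (Set.mem_Ici.2 (div_nonneg (hf x) ha.le)) (Set.mem_Ici.2 (div_nonneg (hg x) hb.le))
      (show 0 ≤ a / (a + b) by positivity) (show 0 ≤ b / (a + b) by positivity)
      (by field_simp)
    simp only [smul_eq_mul, div_pow] at h
    have h3 : a / (a + b) * (f x / a) + b / (a + b) * (g x / b) = (f x + g x) / (a + b) := by
      field_simp
    rw [h3, div_pow, div_le_iff₀ (by positivity)] at h
    refine h.trans (le_of_eq ?_)
    ring
  calc 𝔼 x, (f x + g x) ^ m ≤ 𝔼 x, (a + b) ^ m *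
        (a / (a + b) * (1 / a ^ m * f x ^ m) + b / (a + b) * (1 / b ^ m * g x ^ m)) :=
        expect_le_expect fun x _ => key x
    _ = (a + b) ^ m * (a / (a + b) * (1 / a ^ m * 𝔼 x, f x ^ m) +
          b / (a + b) * (1 / b ^ m * 𝔼 x, g x ^ m)) := by
        simp only [← mul_expect, expect_add_distrib]
    _ ≤ (a + b) ^ m * (a / (a + b) * (1 / a ^ m * (a ^ m * T)) +
          b / (a + b) * (1 / b ^ m * (b ^ m * T))) := by gcongr
    _ = _ := by field_simp

/-- The `L^m` bound with constant `D` for the maximal function over planes spanned by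
`2 × n` matrices with a unit minor, over a finite ring. -/
def PlaneBound (R : Type*) [CommRing R] [Fintype R] (n m : ℕ) (D : ℝ) : Prop :=
  ∀ (φ : (Fin n → R) → ℝ) (M : (Fin 2 → Fin n → R) → ℝ), (∀ z, 0 ≤ φ z) → (∀ g, 0 ≤ M g) →
    (∀ g, (∃ i k, IsUnit (g 0 i * g 1 k - g 0 k * g 1 i)) ∨ M g = 0) →
    (∀ g, ∃ a, M g ≤ 𝔼 s : R, 𝔼 t : R, φ (a + s • g 0 + t • g 1)) →
    𝔼 g, M g ^ m ≤ D ^ m * 𝔼 z, φ z ^ m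

/-- The analogue of `PlaneBound` for the oscillating part of the weight. -/
def PlaneOscBound {R : Type*} [CommRing R] [Fintype R] (π : R) (n m : ℕ) (D : ℝ) : Prop :=
  ∀ (φ : (Fin n → R) → ℝ) (M : (Fin 2 → Fin n → R) → ℝ), (∀ z, 0 ≤ φ z) → (∀ g, 0 ≤ M g) →
    (∀ g, (∃ i k, IsUnit (g 0 i * g 1 k - g 0 k * g 1 i)) ∨ M g = 0) →
    (∀ g, ∃ a, M g ≤ |𝔼 s : R, 𝔼 t : R, osc π φ (a + s • g 0 + t • g 1)|) →
    𝔼 g, M g ^ m ≤ D ^ m * 𝔼 z, φ z ^ m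

theorem PlaneBound.step {R R' : Type*} [CommRing R] [Fintype R] [CommRing R'] [Fintype R']
    (c : R →+* R') (hc : Function.Surjective c) {π : R} (hπ : ∀ r, c r = 0 ↔ ∃ s, r = π * s)
    {n m : ℕ} {D β : ℝ} (hD : 0 < D) (hβ : 0 < β) (h : PlaneBound R' n (m + 1) D)
    (ho : PlaneOscBound π n (m + 1) β) : PlaneBound R n (m + 1) (D + β) := by
  classical
  intro φ M hφ hM hMg hMφ
  let cv : (Fin n → R) →+ (Fin n → R') := c.toAddMonoidHom.compLeft (Fin n)
  have hcv : Function.Surjective cv := hc.comp_left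
  let cm : (Fin 2 → Fin n → R) →+ (Fin 2 → Fin n → R') := cv.compLeft (Fin 2)
  have hcm : Function.Surjective cm := hcv.comp_left
  choose l hl using hcv
  have hpi : ∀ h, cv (π • h) = 0 := fun h => by
    ext i
    exact (hπ _).2 ⟨h i, rfl⟩
  have hker : ∀ z, ∃ h, z = l (cv z) + π • h := fun z => by
    have h1 : cv (z - l (cv z)) = 0 := by rw [map_sub, hl, sub_self]
    choose h hh using fun i => (hπ ((z - l (cv z)) i)).1 (congrFun h1 i)
    exact ⟨h, by ext i; simpa [sub_eq_iff_eq_add'] using hh i⟩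
  have hfib : ∀ (F : (Fin n → R) → ℝ) z, 𝔼 h, F (z + π • h) = 𝔼 h, F (l (cv z) + π • h) :=
    fun F z => by
    obtain ⟨h₀, hh₀⟩ := hker z
    refine Fintype.expect_equiv (Equiv.addLeft h₀) _ _ fun h => ?_
    conv_lhs => rw [hh₀]
    rw [Equiv.coe_addLeft, smul_add, add_assoc]
  let ψ : (Fin n → R') → ℝ := fun x => 𝔼 h, φ (l x + π • h)
  have hψ0 : ∀ x, 0 ≤ ψ x := fun x => expect_nonneg fun h _ => hφ _
  have hosc : ∀ z, φ z = osc π φ z + ψ (cv z) := fun z => by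
    rw [osc, ← Fintype.expect_eq_sum_div_card, hfib φ z, sub_add_cancel]
  have hψφ : 𝔼 x, ψ x ^ (m + 1) ≤ 𝔼 z, φ z ^ (m + 1) := by
    calc 𝔼 x, ψ x ^ (m + 1) ≤ 𝔼 x, 𝔼 h, φ (l x + π • h) ^ (m + 1) :=
          expect_le_expect fun x _ => expect_pow_le m _ fun h => hφ _
      _ = 𝔼 z, 𝔼 h, φ (z + π • h) ^ (m + 1) := by
          rw [← expect_comp_of_surjective cv fun x => ⟨l x, hl x⟩]
          exact expect_congr rfl fun z _ => (hfib (fun z => φ z ^ (m + 1)) z).symm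
      _ = 𝔼 h : Fin n → R, 𝔼 z, φ (z + π • h) ^ (m + 1) := expect_comm _ _ _
      _ = 𝔼 h : Fin n → R, 𝔼 z, φ z ^ (m + 1) := expect_congr rfl fun h _ =>
          Fintype.expect_equiv (Equiv.addRight (π • h)) _ _ fun z => rfl
      _ = _ := Fintype.expect_const _
  let U : (Fin 2 → Fin n → R) → Prop := fun g => ∃ i k, IsUnit (g 0 i * g 1 k - g 0 k * g 1 i)
  let U' : (Fin 2 → Fin n → R') → Prop := fun g => ∃ i k, IsUnit (g 0 i * g 1 k - g 0 k * g 1 i)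
  have hUU' : ∀ g, U g → U' (cm g) := by
    rintro g ⟨i, k, hik⟩
    exact ⟨i, k, by simpa [cm, cv] using hik.map c⟩
  let P : (Fin 2 → Fin n → R') → (Fin n → R') → ℝ := fun g a =>
    𝔼 s : R', 𝔼 t : R', ψ (a + s • g 0 + t • g 1)
  let Q : (Fin 2 → Fin n → R) → (Fin n → R) → ℝ := fun g a =>
    |𝔼 s : R, 𝔼 t : R, osc π φ (a + s • g 0 + t • g 1)|
  choose aP haP using fun g => Finite.exists_max (P g)
  choose aQ haQ using fun g => Finite.exists_max (Q g)
  have hP0 : ∀ g a, 0 ≤ P g a := fun g a => expect_nonneg fun s _ => expect_nonneg fun t _ => hψ0 _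
  have h1 := h ψ (fun g => if U' g then P g (aP g) else 0) hψ0
    (fun g => by split_ifs; exacts [hP0 _ _, le_rfl])
    (fun g => by split_ifs with h; exacts [.inl h, .inr rfl])
    (fun g => ⟨aP g, by split_ifs; exacts [le_rfl, hP0 _ _]⟩)
  have h2 := ho φ (fun g => if U g then Q g (aQ g) else 0) hφ
    (fun g => by split_ifs; exacts [abs_nonneg _, le_rfl])
    (fun g => by split_ifs with h; exacts [.inl h, .inr rfl])
    (fun g => ⟨aQ g, by split_ifs; exacts [le_rfl, abs_nonneg _]⟩)
  rw [← expect_comp_of_surjective cm hcm] at h1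
  refine le_trans (expect_le_expect fun g _ => pow_le_pow_left₀ (hM g) ?_ _)
    (expect_add_pow_le hD hβ (fun g => ?_) (fun g => ?_)
      (h1.trans (mul_le_mul_of_nonneg_left hψφ (by positivity))) h2)
  · rcases hMg g with hg | hg
    · rw [if_pos (hUU' g hg), if_pos hg]
      obtain ⟨a, ha⟩ := hMφ g
      have h3 : 𝔼 s : R, 𝔼 t : R, φ (a + s • g 0 + t • g 1) =
          P (cm g) (cv a) + 𝔼 s : R, 𝔼 t : R, osc π φ (a + s • g 0 + t • g 1) := by
        have h4 : P (cm g) (cv a) = 𝔼 s : R, 𝔼 t : R, ψ (cv (a + s • g 0 + t • g 1)) := by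
          simp only [P]
          rw [← expect_comp_of_surjective c.toAddMonoidHom hc]
          refine expect_congr rfl fun s _ => ?_
          rw [← expect_comp_of_surjective c.toAddMonoidHom hc]
          refine expect_congr rfl fun t _ => ?_
          congr 1
          ext i
          simp [cm, cv]
        rw [h4, ← expect_add_distrib]
        refine expect_congr rfl fun s _ => ?_
        rw [← expect_add_distrib]
        refine expect_congr rfl fun t _ => ?_
        rw [hosc (a + s • g 0 + t • g 1), add_comm]
      calc M g ≤ _ := ha
        _ = _ := h3
        _ ≤ _ := add_le_add (haP _ _) ((le_abs_self _).trans (haQ g a))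
    · rw [hg]
      refine add_nonneg ?_ ?_ <;> split_ifs
      exacts [hP0 _ _, le_rfl, abs_nonneg _, le_rfl]
  · split_ifs
    exacts [hP0 _ _, le_rfl]
  · split_ifs
    exacts [abs_nonneg _, le_rfl]

end Telescoping

section ZModBound

open Finset
open scoped BigOperators

theorem planeOscBound_zmod (p q : ℕ) [Fact p.Prime] : ∃ C : ℝ, 0 < C ∧ ∀ (j : ℕ) (β : ℝ),
    C * (j + 2) ^ (2 * q + 4) / p ^ (j + 1) ≤ β ^ (q + 1) →
      PlaneOscBound (p ^ j : ZMod (p ^ (j + 1))) (q + 2) (q + 1) β := by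
  classical
  obtain ⟨C, hC, h⟩ := sum_matrix_osc_le p q
  refine ⟨C, hC, fun j β hβ φ M hφ hM hMg hMφ => ?_⟩
  have hp : (0 : ℝ) < p := by exact_mod_cast (Fact.out : p.Prime).pos
  set N : ℝ := (p : ℝ) ^ (j + 1) with hN
  have hN0 : 0 < N := by positivity
  let S : Finset (Fin 2 → Fin (q + 2) → ZMod (p ^ (j + 1))) :=
    {g | ∃ i k, IsUnit (g 0 i * g 1 k - g 0 k * g 1 i)}
  have h1 := h j φ (fun g => N ^ 2 * M g) S hφ (fun g => mul_nonneg (by positivity) (hM g))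
    (fun g => by
      obtain ⟨a, ha⟩ := hMφ g
      refine ⟨a, ?_⟩
      simp only [Fintype.expect_eq_sum_div_card, ← sum_div, ZMod.card] at ha
      push_cast at ha
      rw [← hN, div_div, abs_div, abs_of_pos (mul_pos hN0 hN0), le_div_iff₀ (by positivity)] at ha
      calc N ^ 2 * M g = M g * (N * N) := by ring
        _ ≤ _ := ha)
    (fun g hg => (mem_filter.1 hg).2)
  have h2 : ∑ g ∈ S, (N ^ 2 * M g) ^ (q + 1) = N ^ (2 * q + 2) * ∑ g, M g ^ (q + 1) := by
    rw [mul_sum, sum_subset (subset_univ S)]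
    · refine sum_congr rfl fun g _ => ?_
      ring
    · intro g _ hg
      have : M g = 0 := (hMg g).resolve_left fun h => hg (mem_filter.2 ⟨mem_univ _, h⟩)
      simp [this]
  rw [h2] at h1
  have h0 : 0 ≤ ∑ z, φ z ^ (q + 1) := sum_nonneg fun z _ => pow_nonneg (hφ z) _
  simp only [Fintype.expect_eq_sum_div_card, Fintype.card_pi, ZMod.card, prod_const, card_univ,
    Fintype.card_fin]
  push_cast
  rw [← hN]
  calc (∑ g, M g ^ (q + 1)) / (N ^ (q + 2)) ^ 2
      = (N ^ (2 * q + 2) * ∑ g, M g ^ (q + 1)) / N ^ (4 * q + 6) := by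
        rw [div_eq_div_iff (by positivity) (by positivity)]
        ring
    _ ≤ (C * (j + 2) ^ (2 * q + 4) * N ^ (3 * q + 3) * ∑ z, φ z ^ (q + 1)) / N ^ (4 * q + 6) := by
        gcongr
    _ = C * (j + 2) ^ (2 * q + 4) / N * ((∑ z, φ z ^ (q + 1)) / N ^ (q + 2)) := by
        rw [div_mul_div_comm, div_eq_div_iff (by positivity) (by positivity)]
        ring
    _ ≤ _ := by gcongr

theorem castHom_zmod_eq_zero_iff (p k : ℕ) (r : ZMod (p ^ (k + 1))) :
    ZMod.castHom (pow_dvd_pow p k.le_succ) (ZMod (p ^ k)) r = 0 ↔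
      ∃ s, r = (p ^ k : ZMod (p ^ (k + 1))) * s := by
  constructor
  · intro h
    obtain ⟨n, rfl⟩ := ZMod.intCast_surjective r
    rw [map_intCast, ZMod.intCast_zmod_eq_zero_iff_dvd] at h
    obtain ⟨m, rfl⟩ := h
    exact ⟨m, by push_cast; rfl⟩
  · rintro ⟨s, rfl⟩
    rw [map_mul, map_pow, map_natCast]
    have : ((p ^ k : ℕ) : ZMod (p ^ k)) = 0 := ZMod.natCast_self _
    push_cast at this
    rw [this, zero_mul]

theorem planeBound_zmod (p q : ℕ) [Fact p.Prime] : ∃ D : ℝ, 0 < D ∧ ∀ k : ℕ,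
    PlaneBound (ZMod (p ^ k)) (q + 2) (q + 1) D := by
  classical
  obtain ⟨C, hC, hosc⟩ := planeOscBound_zmod p q
  have hp : (1 : ℝ) < p := by exact_mod_cast (Fact.out : p.Prime).one_lt
  have hp0 : (0 : ℝ) < p := by linarith
  set r : ℝ := (p⁻¹ : ℝ) ^ ((q + 1 : ℕ) : ℝ)⁻¹ with hr
  have hr0 : 0 < r := by positivity
  have hrp : r ^ (q + 1) = (p : ℝ)⁻¹ := Real.rpow_inv_natCast_pow (by positivity) (by omega)
  have hr1 : r < 1 := by
    by_contra! h
    have h1 := one_le_pow₀ h (n := q + 1)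
    rw [hrp] at h1
    exact absurd h1 (not_le.2 (inv_lt_one_of_one_lt₀ hp))
  let β : ℕ → ℝ := fun j => (C + 1) * (((j + 2 : ℕ) : ℝ) ^ (2 * q + 4) * r ^ (j + 2)) / r
  have hβ0 : ∀ j, 0 < β j := fun j => by positivity
  have hβs : Summable β := by
    have h1 := summable_pow_mul_geometric_of_norm_lt_one (R := ℝ) (2 * q + 4) (r := r)
      (by rwa [Real.norm_of_nonneg hr0.le])
    exact (((summable_nat_add_iff 2).2 h1).mul_left (C + 1)).div_const r
  have hβ : ∀ j : ℕ, C * (j + 2) ^ (2 * q + 4) / p ^ (j + 1) ≤ β j ^ (q + 1) := fun j => by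
    have h1 : β j = (C + 1) * (j + 2) ^ (2 * q + 4) * r ^ (j + 1) := by
      simp only [β]
      push_cast
      rw [pow_succ r (j + 1)]
      field_simp
    have h2 : (r ^ (j + 1)) ^ (q + 1) = (p ^ (j + 1) : ℝ)⁻¹ := by
      rw [← pow_mul, mul_comm, pow_mul, hrp, inv_pow]
    rw [h1, mul_pow, h2, div_eq_mul_inv]
    have h3 : (1 : ℝ) ≤ (C + 1) * (j + 2) ^ (2 * q + 4) :=
      one_le_mul_of_one_le_of_one_le (by linarith) (one_le_pow₀ (by linarith [j.cast_nonneg (α := ℝ)]))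
    gcongr
    calc C * (j + 2) ^ (2 * q + 4) ≤ (C + 1) * (j + 2) ^ (2 * q + 4) := by gcongr; linarith
      _ ≤ _ := le_self_pow₀ h3 (by omega)
  have hk : ∀ k : ℕ, PlaneBound (ZMod (p ^ k)) (q + 2) (q + 1) (1 + ∑ j ∈ range k, β j) := by
    intro k
    induction k with
    | zero =>
      intro φ M hφ hM _ hMφ
      have : Subsingleton (ZMod (p ^ 0)) := by
        rw [← Fintype.card_le_one_iff_subsingleton, ZMod.card, pow_zero]
      have hc : ∀ z, φ z = φ 0 := fun z => by rw [Subsingleton.elim z 0]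
      have hle : ∀ g, M g ≤ φ 0 := fun g => by
        obtain ⟨a, ha⟩ := hMφ g
        simpa only [hc, Fintype.expect_const] using ha
      rw [range_zero, sum_empty, add_zero, one_pow, one_mul]
      calc 𝔼 g, M g ^ (q + 1) ≤ 𝔼 g : Fin 2 → Fin (q + 2) → ZMod (p ^ 0), φ 0 ^ (q + 1) :=
            expect_le_expect fun g _ => pow_le_pow_left₀ (hM g) (hle g) _
        _ = φ 0 ^ (q + 1) := Fintype.expect_const _
        _ = 𝔼 z : Fin (q + 2) → ZMod (p ^ 0), φ 0 ^ (q + 1) := (Fintype.expect_const _).symm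
        _ ≤ _ := le_of_eq (expect_congr rfl fun z _ => by rw [hc z])
    | succ k ih =>
      rw [sum_range_succ, ← add_assoc]
      refine PlaneBound.step (ZMod.castHom (pow_dvd_pow p k.le_succ) (ZMod (p ^ k)))
        (ZMod.castHom_surjective _) (castHom_zmod_eq_zero_iff p k) ?_ (hβ0 k) ih (hosc k _ (hβ k))
      exact add_pos_of_pos_of_nonneg one_pos (sum_nonneg fun j _ => (hβ0 j).le)
  have hT : 0 ≤ ∑' j, β j := tsum_nonneg fun j => (hβ0 j).le
  refine ⟨1 + ∑' j, β j, by positivity, fun k φ M hφ hM hMg hMφ => ?_⟩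
  refine (hk k φ M hφ hM hMg hMφ).trans ?_
  have h0 : 0 ≤ ∑ j ∈ range k, β j := sum_nonneg fun j _ => (hβ0 j).le
  have h1 : 0 ≤ 𝔼 z, φ z ^ (q + 1) := expect_nonneg fun z _ => pow_nonneg (hφ z) _
  have h2 := hβs.sum_le_tsum (range k) fun j _ => (hβ0 j).le
  gcongr

end ZModBound

section Reduction

open Finset
open scoped BigOperators

/-- Reduction of vectors modulo `p ^ k`. -/
def redVec (p : ℕ) [Fact p.Prime] (k n : ℕ) : (Fin n → ℤ_[p]) →+ (Fin n → ZMod (p ^ k)) :=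
  (PadicInt.toZModPow k).toAddMonoidHom.compLeft (Fin n)

/-- Reduction of `2 × n` matrices modulo `p ^ k`. -/
def redMat (p : ℕ) [Fact p.Prime] (k n : ℕ) :
    (Fin 2 → Fin n → ℤ_[p]) →+ (Fin 2 → Fin n → ZMod (p ^ k)) :=
  (redVec p k n).compLeft (Fin 2)

variable {p : ℕ} [Fact p.Prime] {k n : ℕ}

theorem redVec_apply (x : Fin n → ℤ_[p]) (i : Fin n) :
    redVec p k n x i = PadicInt.toZModPow k (x i) := rfl

theorem redMat_apply (g : Fin 2 → Fin n → ℤ_[p]) (i : Fin 2) (j : Fin n) :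
    redMat p k n g i j = PadicInt.toZModPow k (g i j) := rfl

theorem redVec_surjective : Function.Surjective (redVec p k n) :=
  (ZMod.ringHom_surjective (PadicInt.toZModPow k)).comp_left

theorem redMat_surjective : Function.Surjective (redMat p k n) :=
  redVec_surjective.comp_left

theorem toZModPow_eq_iff {x y : ℤ_[p]} :
    PadicInt.toZModPow k x = PadicInt.toZModPow k y ↔ dist x y ≤ (p : ℝ) ^ (-k : ℤ) := by
  rw [dist_eq_norm, PadicInt.norm_le_pow_iff_mem_span_pow, ← PadicInt.ker_toZModPow,
    RingHom.mem_ker, map_sub, sub_eq_zero]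

theorem radius_pos : 0 < (p : ℝ) ^ (-k : ℤ) := by
  have := (Fact.out : p.Prime).pos
  positivity

theorem redVec_eq_iff {x y : Fin n → ℤ_[p]} :
    redVec p k n x = redVec p k n y ↔ dist x y ≤ (p : ℝ) ^ (-k : ℤ) := by
  rw [dist_pi_le_iff radius_pos.le, funext_iff]
  exact forall_congr' fun i => toZModPow_eq_iff

theorem redMat_eq_iff {x y : Fin 2 → Fin n → ℤ_[p]} :
    redMat p k n x = redMat p k n y ↔ dist x y ≤ (p : ℝ) ^ (-k : ℤ) := by
  rw [dist_pi_le_iff radius_pos.le, funext_iff]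
  exact forall_congr' fun i => redVec_eq_iff

theorem measurableSet_preimage_of_dist {X A : Type*} [PseudoMetricSpace X] [MeasurableSpace X]
    [BorelSpace X] {c : X → A} {δ : ℝ} (hδ : 0 < δ) (h : ∀ x y, dist x y ≤ δ → c x = c y)
    (s : Set A) : MeasurableSet (c ⁻¹' s) := by
  refine IsOpen.measurableSet (Metric.isOpen_iff.2 fun x hx => ⟨δ, hδ, fun y hy => ?_⟩)
  rw [Set.mem_preimage, h y x (Metric.mem_ball.1 hy).le]
  exact hx

theorem measurableSet_redVec (s : Set (Fin n → ZMod (p ^ k))) :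
    MeasurableSet (redVec p k n ⁻¹' s) :=
  measurableSet_preimage_of_dist radius_pos (fun _ _ => redVec_eq_iff.2) s

theorem measurableSet_redMat (s : Set (Fin 2 → Fin n → ZMod (p ^ k))) :
    MeasurableSet (redMat p k n ⁻¹' s) :=
  measurableSet_preimage_of_dist radius_pos (fun _ _ => redMat_eq_iff.2) s

theorem measurable_comp_redVec {β : Type*} [MeasurableSpace β] (F : (Fin n → ZMod (p ^ k)) → β) :
    Measurable fun x => F (redVec p k n x) := fun s _ => measurableSet_redVec (F ⁻¹' s)

theorem measurable_comp_redMat {β : Type*} [MeasurableSpace β]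
    (F : (Fin 2 → Fin n → ZMod (p ^ k)) → β) :
    Measurable fun x => F (redMat p k n x) := fun s _ => measurableSet_redMat (F ⁻¹' s)

theorem lintegral_comp_addMonoidHom {G A : Type*} [AddCommGroup G] [MeasurableSpace G]
    [MeasurableAdd G] (μ : Measure G) [IsProbabilityMeasure μ] [μ.IsAddLeftInvariant]
    [AddCommGroup A] [Fintype A] (c : G →+ A) (hc : Function.Surjective c)
    (hm : ∀ s : Set A, MeasurableSet (c ⁻¹' s)) (F : A → ℝ) (hF : ∀ a, 0 ≤ F a) :
    ∫⁻ x, ENNReal.ofReal (F (c x)) ∂μ = ENNReal.ofReal (𝔼 a, F a) := by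
  classical
  have hinv : ∀ a, μ (c ⁻¹' {a}) = μ (c ⁻¹' {0}) := fun a => by
    obtain ⟨x, hx⟩ := hc a
    rw [← measure_preimage_add μ x (c ⁻¹' {a})]
    congr 1
    ext y
    simp [hx]
  have hsum : ∀ H : A → ℝ≥0∞, ∫⁻ x, H (c x) ∂μ = (∑ a, H a) * μ (c ⁻¹' {0}) := fun H => by
    have h1 : ∀ x, H (c x) = ∑ a, (c ⁻¹' {a}).indicator (fun _ => H a) x := fun x => by
      rw [sum_eq_single (c x)]
      · simp
      · intro b _ hb
        simp [hb.symm]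
      · simp
    simp_rw [h1]
    rw [lintegral_finsetSum _ fun a _ => measurable_const.indicator (hm _), sum_mul]
    refine sum_congr rfl fun a _ => ?_
    rw [lintegral_indicator_const (hm _), hinv]
  have hcard : (Fintype.card A : ℝ≥0∞) * μ (c ⁻¹' {0}) = 1 := by
    have := hsum fun _ => 1
    simpa using this.symm
  have h0 : (0 : ℝ) < Fintype.card A := by exact_mod_cast Fintype.card_pos
  have hμ : μ (c ⁻¹' {0}) = (Fintype.card A : ℝ≥0∞)⁻¹ :=
    ENNReal.eq_inv_of_mul_eq_one_left (by rwa [mul_comm])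
  rw [hsum fun a => ENNReal.ofReal (F a), hμ, Fintype.expect_eq_sum_div_card,
    ENNReal.ofReal_div_of_pos h0, ENNReal.ofReal_natCast, ENNReal.ofReal_sum_of_nonneg fun a _ => hF a,
    div_eq_mul_inv]

instance : (padicHaar p n).IsAddHaarMeasure := by unfold padicHaar; infer_instance
instance : (matHaar p n).IsAddHaarMeasure := by unfold matHaar; infer_instance
instance : (padicHaar p n).WeaklyRegular := by unfold padicHaar; infer_instance
instance : IsProbabilityMeasure (padicHaar p n) := ⟨Measure.addHaarMeasure_self⟩
instance : IsProbabilityMeasure (matHaar p n) := ⟨Measure.addHaarMeasure_self⟩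

theorem lintegral_padicHaar_comp_redVec (F : (Fin n → ZMod (p ^ k)) → ℝ) (hF : ∀ a, 0 ≤ F a) :
    ∫⁻ x, ENNReal.ofReal (F (redVec p k n x)) ∂(padicHaar p n) = ENNReal.ofReal (𝔼 a, F a) :=
  lintegral_comp_addMonoidHom _ _ redVec_surjective measurableSet_redVec F hF

theorem lintegral_matHaar_comp_redMat (F : (Fin 2 → Fin n → ZMod (p ^ k)) → ℝ)
    (hF : ∀ a, 0 ≤ F a) :
    ∫⁻ x, ENNReal.ofReal (F (redMat p k n x)) ∂(matHaar p n) = ENNReal.ofReal (𝔼 a, F a) :=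
  lintegral_comp_addMonoidHom _ _ redMat_surjective measurableSet_redMat F hF

theorem redVec_plane (a : Fin n → ℤ_[p]) (g : Fin 2 → Fin n → ℤ_[p]) (s : Fin 2 → ℤ_[p]) :
    redVec p k n (fun j => a j + s 0 * g 0 j + s 1 * g 1 j) =
      redVec p k n a + redVec p k 2 s 0 • redMat p k n g 0 +
        redVec p k 2 s 1 • redMat p k n g 1 := by
  ext j
  simp [redVec_apply, redMat_apply]

theorem expect_fin_two {R : Type*} [Fintype R] (F : R → R → ℝ) :
    𝔼 s : Fin 2 → R, F (s 0) (s 1) = 𝔼 s, 𝔼 t, F s t := by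
  simp only [Fintype.expect_eq_sum_div_card, Fintype.card_pi, prod_const, card_univ,
    Fintype.card_fin, ← sum_div]
  push_cast
  rw [div_div, ← sq, Fintype.sum_equiv (finTwoArrowEquiv R) (fun s => F (s 0) (s 1))
    (fun x => F x.1 x.2) fun s => rfl, Fintype.sum_prod_type]

theorem maxOp2_comp_redVec (φ : (Fin n → ZMod (p ^ k)) → ℝ) (hφ : ∀ z, 0 ≤ φ z)
    (g : Fin 2 → Fin n → ℤ_[p]) :
    maxOp2 p n (fun x => ENNReal.ofReal (φ (redVec p k n x))) g =
      ⨆ b, ENNReal.ofReal (𝔼 s : ZMod (p ^ k), 𝔼 t : ZMod (p ^ k),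
        φ (b + s • redMat p k n g 0 + t • redMat p k n g 1)) := by
  rw [maxOp2, ← (redVec_surjective (p := p) (k := k) (n := n)).iSup_comp]
  refine iSup_congr fun a => ?_
  simp only [redVec_plane]
  rw [lintegral_padicHaar_comp_redVec (fun s : Fin 2 → ZMod (p ^ k) =>
    φ (redVec p k n a + s 0 • redMat p k n g 0 + s 1 • redMat p k n g 1)) fun s => hφ _]
  exact congrArg ENNReal.ofReal (expect_fin_two fun s t =>
    φ (redVec p k n a + s • redMat p k n g 0 + t • redMat p k n g 1))

theorem measurable_maxOp2_comp_redVec (φ : (Fin n → ZMod (p ^ k)) → ℝ) (hφ : ∀ z, 0 ≤ φ z) :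
    Measurable (maxOp2 p n fun x => ENNReal.ofReal (φ (redVec p k n x))) := by
  rw [funext (maxOp2_comp_redVec φ hφ)]
  exact measurable_comp_redMat fun γ => ⨆ b, ENNReal.ofReal (𝔼 s : ZMod (p ^ k),
    𝔼 t : ZMod (p ^ k), φ (b + s • γ 0 + t • γ 1))

theorem isOpen_grSet : IsOpen (grSet p n) := by
  have : grSet p n = ⋃ i, ⋃ j, {g | IsUnit (g 0 i * g 1 j - g 0 j * g 1 i)} := by
    ext g
    simp [grSet, unitMinor]
  rw [this]
  exact isOpen_iUnion fun i => isOpen_iUnion fun j => Units.isOpen.preimage (by fun_prop)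

theorem matHaar_grSet_ne_zero (q : ℕ) : matHaar p (q + 2) (grSet p (q + 2)) ≠ 0 := by
  refine isOpen_grSet.measure_ne_zero _ ⟨![Pi.single 0 1, Pi.single 1 1], 0, 1, ?_⟩
  simp

theorem setLIntegral_maxOp2_comp_redVec_le {m : ℕ} {D : ℝ} (hD : 0 < D)
    (hb : PlaneBound (ZMod (p ^ k)) n m D) (φ : (Fin n → ZMod (p ^ k)) → ℝ) (hφ : ∀ z, 0 ≤ φ z) :
    ∫⁻ g in grSet p n, maxOp2 p n (fun x => ENNReal.ofReal (φ (redVec p k n x))) g ^ m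
        ∂(matHaar p n) ≤
      ENNReal.ofReal (D ^ m) * ∫⁻ x, ENNReal.ofReal (φ (redVec p k n x)) ^ m ∂(padicHaar p n) := by
  classical
  let U : (Fin 2 → Fin n → ZMod (p ^ k)) → Prop := fun g =>
    ∃ i j, IsUnit (g 0 i * g 1 j - g 0 j * g 1 i)
  let Q : (Fin 2 → Fin n → ZMod (p ^ k)) → (Fin n → ZMod (p ^ k)) → ℝ := fun γ b =>
    𝔼 s : ZMod (p ^ k), 𝔼 t : ZMod (p ^ k), φ (b + s • γ 0 + t • γ 1)
  have hQ0 : ∀ γ b, 0 ≤ Q γ b := fun γ b =>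
    expect_nonneg fun s _ => expect_nonneg fun t _ => hφ _
  choose b hb_max using fun γ => Finite.exists_max (Q γ)
  let M : (Fin 2 → Fin n → ZMod (p ^ k)) → ℝ := fun γ => if U γ then Q γ (b γ) else 0
  have hM0 : ∀ γ, 0 ≤ M γ := fun γ => by
    simp only [M]
    split_ifs
    exacts [hQ0 _ _, le_rfl]
  have h1 := hb φ M hφ hM0
    (fun γ => by simp only [M]; split_ifs with h; exacts [.inl h, .inr rfl])
    (fun γ => ⟨b γ, by simp only [M]; split_ifs; exacts [le_rfl, hQ0 _ _]⟩)
  calc _ ≤ ∫⁻ g in grSet p n, ENNReal.ofReal (M (redMat p k n g) ^ m) ∂(matHaar p n) := by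
        refine setLIntegral_mono' isOpen_grSet.measurableSet fun g hg => ?_
        have hU : U (redMat p k n g) := by
          obtain ⟨i, j, hij⟩ := hg
          exact ⟨i, j, by simpa [redMat_apply] using hij.map (PadicInt.toZModPow (p := p) k)⟩
        rw [ENNReal.ofReal_pow (hM0 _), maxOp2_comp_redVec φ hφ]
        gcongr
        simp only [M, if_pos hU]
        exact iSup_le fun a => ENNReal.ofReal_le_ofReal (hb_max _ a)
    _ ≤ ∫⁻ g, ENNReal.ofReal (M (redMat p k n g) ^ m) ∂(matHaar p n) :=
        setLIntegral_le_lintegral _ _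
    _ = ENNReal.ofReal (𝔼 γ, M γ ^ m) :=
        lintegral_matHaar_comp_redMat (fun γ => M γ ^ m) fun γ => pow_nonneg (hM0 γ) _
    _ ≤ ENNReal.ofReal (D ^ m * 𝔼 z, φ z ^ m) := ENNReal.ofReal_le_ofReal h1
    _ = _ := by
        rw [ENNReal.ofReal_mul (by positivity), ← lintegral_padicHaar_comp_redVec
          (fun z => φ z ^ m) fun z => pow_nonneg (hφ z) _]
        simp only [ENNReal.ofReal_pow (hφ _)]

end Reduction

section Approximation

theorem exists_iSup_pow_eq_of_lowerSemicontinuous {p : ℕ} [Fact p.Prime] {n m : ℕ} (hm : m ≠ 0)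
    {G : (Fin n → ℤ_[p]) → ℝ≥0∞} (hG : LowerSemicontinuous G) :
    ∃ φ : ∀ k, (Fin n → ZMod (p ^ k)) → ℝ, (∀ k z, 0 ≤ φ k z) ∧
      (Monotone fun k x => ENNReal.ofReal (φ k (redVec p k n x))) ∧
      ∀ x, ⨆ k, ENNReal.ofReal (φ k (redVec p k n x)) ^ m = G x := by
  let Γ : ∀ k, (Fin n → ZMod (p ^ k)) → ℝ≥0∞ := fun k z =>
    min k (⨅ y, ⨅ _ : redVec p k n y = z, G y)
  have hp1 : (1 : ℝ) < p := by exact_mod_cast (Fact.out : p.Prime).one_lt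
  have hΓtop : ∀ k z, Γ k z ≠ ⊤ := fun k z =>
    ne_top_of_le_ne_top (ENNReal.natCast_ne_top k) (min_le_left _ _)
  have hφ : ∀ k z, ENNReal.ofReal ((Γ k z ^ (m⁻¹ : ℝ)).toReal) = Γ k z ^ (m⁻¹ : ℝ) := fun k z =>
    ENNReal.ofReal_toReal (ENNReal.rpow_ne_top_of_nonneg (by positivity) (hΓtop k z))
  have hpow : ∀ k z, (Γ k z ^ (m⁻¹ : ℝ)) ^ m = Γ k z := fun k z => by
    rw [← ENNReal.rpow_natCast, ← ENNReal.rpow_mul, inv_mul_cancel₀ (by exact_mod_cast hm),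
      ENNReal.rpow_one]
  refine ⟨fun k z => (Γ k z ^ (m⁻¹ : ℝ)).toReal, fun k z => ENNReal.toReal_nonneg, ?_, fun x => ?_⟩
  · refine monotone_nat_of_le_succ fun k x => ?_
    simp only [hφ]
    refine ENNReal.rpow_le_rpow (min_le_min (by exact_mod_cast k.le_succ) ?_) (by positivity)
    refine le_iInf₂ fun y hy => iInf₂_le y ?_
    rw [redVec_eq_iff] at hy ⊢
    refine hy.trans (zpow_le_zpow_right₀ hp1.le ?_)
    push_cast
    omega
  · simp only [hφ, hpow]
    refine le_antisymm (iSup_le fun k => (min_le_right _ _).trans (iInf_le_of_le x (iInf_le_of_le rfl le_rfl))) ?_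
    refine le_of_forall_lt fun t ht => ?_
    obtain ⟨u, htu, hu⟩ := exists_between ht
    obtain ⟨δ, hδ, hball⟩ := Metric.eventually_nhds_iff.1 (hG x u hu)
    obtain ⟨k₁, hk₁⟩ := exists_pow_lt_of_lt_one hδ (inv_lt_one_of_one_lt₀ hp1)
    obtain ⟨k₂, hk₂⟩ := ENNReal.exists_nat_gt (ne_top_of_lt htu)
    refine lt_of_lt_of_le (lt_min (a := t) (b := ((max k₁ k₂ : ℕ) : ℝ≥0∞)) (hk₂.trans_le ?_)
      (htu.trans_le ?_)) (le_iSup (fun k => Γ k (redVec p k n x)) (max k₁ k₂))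
    · exact_mod_cast le_max_right _ _
    · refine le_iInf₂ fun y hy => (hball (lt_of_le_of_lt (redVec_eq_iff.1 hy) ?_)).le
      refine lt_of_le_of_lt ?_ hk₁
      rw [inv_pow, zpow_neg, zpow_natCast]
      gcongr
      exacts [hp1.le, le_max_left _ _]

theorem setLIntegral_maxOp2_pow_le (p q : ℕ) [Fact p.Prime] : ∃ K : ℝ≥0∞, K ≠ 0 ∧ K ≠ ⊤ ∧
    ∀ F : (Fin (q + 2) → ℤ_[p]) → ℝ≥0∞, Measurable F →
      ∫⁻ g in grSet p (q + 2), maxOp2 p (q + 2) F g ^ (q + 1) ∂(matHaar p (q + 2)) ≤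
        K * ∫⁻ x, F x ^ (q + 1) ∂(padicHaar p (q + 2)) := by
  obtain ⟨D, hD, hbound⟩ := planeBound_zmod p q
  have hK0 : ENNReal.ofReal (D ^ (q + 1)) ≠ 0 := by
    rw [Ne, ENNReal.ofReal_eq_zero, not_le]
    positivity
  refine ⟨ENNReal.ofReal (D ^ (q + 1)), hK0, ENNReal.ofReal_ne_top, fun F hF => ?_⟩
  have key : ∀ ε : ℝ≥0∞, ε ≠ 0 →
      ∫⁻ g in grSet p (q + 2), maxOp2 p (q + 2) F g ^ (q + 1) ∂(matHaar p (q + 2)) ≤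
        ENNReal.ofReal (D ^ (q + 1)) * (∫⁻ x, F x ^ (q + 1) ∂(padicHaar p (q + 2)) + ε) := by
    intro ε hε
    obtain ⟨G, hFG, hGlsc, hGint⟩ := exists_le_lowerSemicontinuous_lintegral_ge
      (padicHaar p (q + 2)) (fun x => F x ^ (q + 1)) (hF.pow_const _) hε
    obtain ⟨φ, hφ0, hmono, hsup⟩ :=
      exists_iSup_pow_eq_of_lowerSemicontinuous (m := q + 1) (by omega) hGlsc
    have hFsup : ∀ x, F x ≤ ⨆ k, ENNReal.ofReal (φ k (redVec p k (q + 2) x)) := fun x => by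
      have h1 := hFG x
      rw [← hsup x, ← ENNReal.iSup_pow] at h1
      exact (ENNReal.pow_le_pow_left_iff (by omega)).1 h1
    let H : ℕ → (Fin (q + 2) → ℤ_[p]) → ℝ≥0∞ := fun k x =>
      ENNReal.ofReal (φ k (redVec p k (q + 2) x))
    have hHm : ∀ k, Measurable (H k) := fun k =>
      measurable_comp_redVec fun z => ENNReal.ofReal (φ k z)
    have hplane : ∀ (a : Fin (q + 2) → ℤ_[p]) (g : Fin 2 → Fin (q + 2) → ℤ_[p]),
        Measurable fun (s : Fin 2 → ℤ_[p]) j => a j + s 0 * g 0 j + s 1 * g 1 j := fun a g =>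
      Continuous.measurable (by fun_prop)
    have hmaxmono : Monotone fun k => maxOp2 p (q + 2) (H k) := fun k l hkl g =>
      iSup_mono fun a => lintegral_mono fun s => hmono hkl (fun j => a j + s 0 * g 0 j + s 1 * g 1 j)
    have hmax : ∀ g, maxOp2 p (q + 2) F g ≤ ⨆ k, maxOp2 p (q + 2) (H k) g := fun g => by
      refine iSup_le fun a => ?_
      let γ : (Fin 2 → ℤ_[p]) → Fin (q + 2) → ℤ_[p] := fun s j =>
        a j + s 0 * g 0 j + s 1 * g 1 j
      have h1 : ∀ k, ∫⁻ s, H k (γ s) ∂(padicHaar p 2) ≤ maxOp2 p (q + 2) (H k) g := fun k =>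
        le_iSup (fun a : Fin (q + 2) → ℤ_[p] => ∫⁻ s : Fin 2 → ℤ_[p],
          H k (fun j => a j + s 0 * g 0 j + s 1 * g 1 j) ∂(padicHaar p 2)) a
      have h2 : ∫⁻ s, ⨆ k, H k (γ s) ∂(padicHaar p 2) = ⨆ k, ∫⁻ s, H k (γ s) ∂(padicHaar p 2) :=
        lintegral_iSup (fun k => (hHm k).comp (hplane a g)) fun k l hkl s => hmono hkl (γ s)
      have h3 : ∫⁻ s, F (γ s) ∂(padicHaar p 2) ≤ ∫⁻ s, ⨆ k, H k (γ s) ∂(padicHaar p 2) :=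
        lintegral_mono fun s => hFsup (γ s)
      exact h3.trans (h2.le.trans (iSup_mono h1))
    calc _ ≤ ∫⁻ g in grSet p (q + 2), ⨆ k, maxOp2 p (q + 2) (H k) g ^ (q + 1)
          ∂(matHaar p (q + 2)) := lintegral_mono fun g => by
          rw [← ENNReal.iSup_pow]
          gcongr
          exact hmax g
      _ = ⨆ k, ∫⁻ g in grSet p (q + 2), maxOp2 p (q + 2) (H k) g ^ (q + 1)
          ∂(matHaar p (q + 2)) :=
        lintegral_iSup (fun k => (measurable_maxOp2_comp_redVec (φ k) (hφ0 k)).pow_const _)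
          fun k l hkl g => pow_le_pow_left' (hmaxmono hkl g) _
      _ ≤ ENNReal.ofReal (D ^ (q + 1)) * ∫⁻ x, G x ∂(padicHaar p (q + 2)) :=
        iSup_le fun k => (setLIntegral_maxOp2_comp_redVec_le hD (hbound k) (φ k) (hφ0 k)).trans <| by
          gcongr with x
          rw [← hsup x]
          exact le_iSup (fun k => ENNReal.ofReal (φ k (redVec p k (q + 2) x)) ^ (q + 1)) k
      _ ≤ _ := by gcongr
  rw [mul_comm, ← ENNReal.div_le_iff hK0 ENNReal.ofReal_ne_top]
  refine ENNReal.le_of_forall_pos_le_add fun ε hε _ => ?_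
  rw [ENNReal.div_le_iff hK0 ENNReal.ofReal_ne_top, mul_comm]
  exact key ε (by exact_mod_cast hε.ne')

end Approximation

/-- Main theorem: the `L^{n-1} → L^{n-1}` bound for the maximal 2-plane operator on
`ℤ_p^n`. There is `C_n > 0` (depending only on `n` and `p`) with
`C_n ∫_{Gr(ℤ_p^n,2)} (𝒩² f)^{n-1} dν ≤ ∫_{ℤ_p^n} |f|^{n-1} dμ` for all measurable `f`. -/
theorem maxOp2_Lp_bound (p : ℕ) [Fact p.Prime] (n : ℕ) (hn : 2 ≤ n) :
    ∃ C : ℝ≥0∞, 0 < C ∧ ∀ f : (Fin n → ℤ_[p]) → ℂ, Measurable f →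
      C * ∫⁻ g, (maxOp2 p n (fun x => (‖f x‖₊ : ℝ≥0∞)) g) ^ (n - 1) ∂(grMeasure p n) ≤
        ∫⁻ x, (‖f x‖₊ : ℝ≥0∞) ^ (n - 1) ∂(padicHaar p n) := by
  obtain ⟨q, rfl⟩ := Nat.exists_eq_add_of_le' hn
  obtain ⟨K, hK0, hKtop, hK⟩ := setLIntegral_maxOp2_pow_le p q
  have hgr0 := matHaar_grSet_ne_zero (p := p) q
  have hgrtop : matHaar p (q + 2) (grSet p (q + 2)) ≠ ⊤ := measure_ne_top _ _
  refine ⟨K⁻¹ * matHaar p (q + 2) (grSet p (q + 2)),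
    ENNReal.mul_pos (ENNReal.inv_ne_zero.2 hKtop) hgr0, fun f hf => ?_⟩
  rw [grMeasure, lintegral_smul_measure, smul_eq_mul, mul_assoc, ← mul_assoc (matHaar _ _ _),
    ENNReal.mul_inv_cancel hgr0 hgrtop, one_mul, mul_comm, ← div_eq_mul_inv,
    ENNReal.div_le_iff hK0 hKtop, mul_comm]
  exact hK _ hf.nnnorm.coe_nnreal_ennreal

end
end
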